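/- Let M = (M,<,…) be an almost o-minimal structure that is not o-minimal, and suppose M is upward o-minimal. Let N be an elementary extension of M in which M is coinitial. Then N is upward o-minimal. -/

import Mathlib

open FirstOrder FirstOrder.Language

universe u v w x

/-- A subset of a linear order is an open interval (possibly unbounded). -/
def IsOpenIntervalSet {M : Type w} [LinearOrder M] (s : Set M) : Prop :=
  (∃ a b : M, s = Set.Ioo a b) ∨ (∃ a : M, s = Set.Ioi a) ∨ (∃ b : M, s = Set.Iio b) ∨
    s = Set.univ

/-- `s` is a finite union of points and open intervals. -/
def IsFinUnionPointsIntervals {M : Type w} [LinearOrder M] (s : Set M) : Prop :=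
  ∃ (F : Finset M) (n : ℕ) (J : Fin n → Set M),
    (∀ k, IsOpenIntervalSet (J k)) ∧ s = ↑F ∪ ⋃ k, J k

/-- `M` is o-minimal: every subset of `M` definable with parameters is a finite union of
points and open intervals. -/
def IsOMinimal (L : FirstOrder.Language.{u, v}) (M : Type w) [L.Structure M]
    [LinearOrder M] : Prop :=
  ∀ s : Set M, (Set.univ : Set M).Definable₁ L s → IsFinUnionPointsIntervals s

/-- `M` is almost o-minimal: every bounded definable (with parameters) subset of `M` is a
finite union of points and open intervals. -/
def IsAlmostOMinimal (L : FirstOrder.Language.{u, v}) (M : Type w) [L.Structure M]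
    [LinearOrder M] : Prop :=
  ∀ s : Set M, (Set.univ : Set M).Definable₁ L s → BddAbove s → BddBelow s →
    IsFinUnionPointsIntervals s

/-- `M` is downward o-minimal: every definable (with parameters) subset of `M` that is
bounded above is a finite union of points and open intervals. -/
def IsDownwardOMinimal (L : FirstOrder.Language.{u, v}) (M : Type w) [L.Structure M]
    [LinearOrder M] : Prop :=
  ∀ s : Set M, (Set.univ : Set M).Definable₁ L s → BddAbove s → IsFinUnionPointsIntervals s

/-- `M` is upward o-minimal: every definable (with parameters) subset of `M` that is
bounded below is a finite union of points and open intervals. -/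
def IsUpwardOMinimal (L : FirstOrder.Language.{u, v}) (M : Type w) [L.Structure M]
    [LinearOrder M] : Prop :=
  ∀ s : Set M, (Set.univ : Set M).Definable₁ L s → BddBelow s → IsFinUnionPointsIntervals s

section OMinimalSystems

open Set Filter Topology

/-- An o-minimal system of definable predicates on a linear order. -/
class OMinSystem (R : Type u) [LinearOrder R] where
  Dfn : ∀ {ι : Type}, ((ι → R) → Prop) → Prop
  top : ∀ {ι : Type}, Dfn fun _ : ι → R => True
  and : ∀ {ι : Type} {P Q : (ι → R) → Prop}, Dfn P → Dfn Q → Dfn fun v => P v ∧ Q v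
  not : ∀ {ι : Type} {P : (ι → R) → Prop}, Dfn P → Dfn fun v => ¬ P v
  ex : ∀ {ι : Type} {P : (ι → R) → R → Prop},
    Dfn (fun v : Option ι → R => P (fun i => v (some i)) (v none)) → Dfn fun v => ∃ x, P v x
  subst : ∀ {ι κ : Type} {P : (ι → R) → Prop} (e : ι → κ ⊕ R), Dfn P →
    Dfn fun v : κ → R => P fun i => Sum.elim v id (e i)
  lt : Dfn fun v : Bool → R => v false < v true
  tame : ∀ {P : (Unit → R) → Prop}, Dfn P → ∃ F : Set R, F.Finite ∧
    ∀ x y, x < y → (∀ z ∈ F, z ∉ Icc x y) → (P (fun _ => x) ↔ P fun _ => y)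

/-- A space in which it makes sense for a map out of a power of `R` to be definable. -/
class DSpace (R : Type u) [LinearOrder R] [OMinSystem R] (X : Type v) where
  Plot : ∀ {ι : Type}, ((ι → R) → X) → Prop
  const : ∀ {ι : Type} (a : X), Plot fun _ : ι → R => a
  reindex : ∀ {ι κ : Type} {p : (ι → R) → X} (e : ι → κ), Plot p →
    Plot fun v : κ → R => p fun i => v (e i)

variable {R : Type u} [LinearOrder R] [OMinSystem R]
variable {X : Type v} {Y : Type w} {Z : Type x} [DSpace R X] [DSpace R Y] [DSpace R Z]

variable (R) in
/-- A map is definable if it sends plots to plots. -/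
@[fun_prop]
def Dm (f : X → Y) : Prop :=
  ∀ ⦃ι : Type⦄ (p : (ι → R) → X), DSpace.Plot p → DSpace.Plot fun v => f (p v)

instance : DSpace R R where
  Plot {ι} p := ∃ e : ι ⊕ R, ∀ v, p v = Sum.elim v id e
  const a := ⟨.inr a, fun _ => rfl⟩
  reindex {ι κ p} e := by
    rintro ⟨i | a, h⟩
    · exact ⟨.inl (e i), fun v => h _⟩
    · exact ⟨.inr a, fun v => h _⟩

instance : DSpace R Prop where
  Plot p := OMinSystem.Dfn p
  const q := by
    by_cases hq : q
    · simpa only [hq] using OMinSystem.top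
    · simpa only [hq, not_true] using OMinSystem.not (OMinSystem.top (R := R))
  reindex e h := OMinSystem.subst (fun i => .inl (e i)) h

instance : DSpace R (X × Y) where
  Plot p := DSpace.Plot (fun v => (p v).1) ∧ DSpace.Plot (fun v => (p v).2)
  const a := ⟨DSpace.const a.1, DSpace.const a.2⟩
  reindex e h := ⟨DSpace.reindex e h.1, DSpace.reindex e h.2⟩

instance {κ : Type*} : DSpace R (κ → X) where
  Plot p := ∀ k, DSpace.Plot (fun v => p v k)
  const a k := DSpace.const (a k)
  reindex e h k := DSpace.reindex e (h k)

namespace Dm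
@[fun_prop] theorem id' : Dm R (fun x : X => x) := fun _ _ h => h
@[fun_prop] theorem const (y : Y) : Dm R (fun _ : X => y) := fun _ _ _ => DSpace.const y
@[fun_prop] theorem comp {f : Y → Z} {g : X → Y} (hf : Dm R f) (hg : Dm R g) :
    Dm R fun x => f (g x) := fun _ _ h => hf _ (hg _ h)
@[fun_prop] theorem fst : Dm R (fun p : X × Y => p.1) := fun _ _ h => h.1
@[fun_prop] theorem snd : Dm R (fun p : X × Y => p.2) := fun _ _ h => h.2
@[fun_prop] theorem prodMk {f : X → Y} {g : X → Z} (hf : Dm R f) (hg : Dm R g) :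
    Dm R fun x => (f x, g x) := fun _ _ h => ⟨hf _ h, hg _ h⟩
@[fun_prop] theorem pi {κ : Type*} {f : X → κ → Y} (hf : ∀ k, Dm R fun x => f x k) :
    Dm R f := fun _ _ h k => hf k _ h
@[fun_prop] theorem apply {κ : Type*} (k : κ) : Dm R fun x : κ → Y => x k := fun _ _ h => h k
@[fun_prop] theorem and {P Q : X → Prop} (hP : Dm R P) (hQ : Dm R Q) :
    Dm R fun x => P x ∧ Q x := fun _ _ h => OMinSystem.and (hP _ h) (hQ _ h)
@[fun_prop] theorem not {P : X → Prop} (hP : Dm R P) :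
    Dm R fun x => ¬ P x := fun _ _ h => OMinSystem.not (hP _ h)
@[fun_prop] theorem or {P Q : X → Prop} (hP : Dm R P) (hQ : Dm R Q) :
    Dm R fun x => P x ∨ Q x := by
  simp only [or_iff_not_and_not]; fun_prop
theorem imp {P Q : X → Prop} (hP : Dm R P) (hQ : Dm R Q) :
    Dm R fun x => P x → Q x := by
  simp only [imp_iff_not_or]; fun_prop
@[fun_prop] theorem iff {P Q : X → Prop} (hP : Dm R P) (hQ : Dm R Q) :
    Dm R fun x => (P x ↔ Q x) := by
  simp only [iff_iff_and_or_not_and_not]; fun_prop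
@[fun_prop] theorem ex {P : X → R → Prop} (hP : Dm R fun p : X × R => P p.1 p.2) :
    Dm R fun x => ∃ y, P x y := fun _ p h =>
  OMinSystem.ex (hP (fun v => (p fun i => v (some i), v none))
    ⟨DSpace.reindex some h, .inl none, fun _ => rfl⟩)
theorem all {P : X → R → Prop} (hP : Dm R fun p : X × R => P p.1 p.2) :
    Dm R fun x => ∀ y, P x y := by
  simp only [← not_exists_not (p := P _)]; fun_prop
@[fun_prop] theorem lt {f g : X → R} (hf : Dm R f) (hg : Dm R g) :
    Dm R fun x => f x < g x := by
  intro ι p h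
  obtain ⟨e, he⟩ := hf _ h
  obtain ⟨e', he'⟩ := hg _ h
  have := OMinSystem.subst (fun b => cond b e' e) (OMinSystem.lt (R := R))
  simpa [DSpace.Plot, he, he'] using this
@[fun_prop] theorem le {f g : X → R} (hf : Dm R f) (hg : Dm R g) :
    Dm R fun x => f x ≤ g x := by
  simp only [← not_lt]; fun_prop
@[fun_prop] theorem eq {f g : X → R} (hf : Dm R f) (hg : Dm R g) :
    Dm R fun x => f x = g x := by
  simp only [le_antisymm_iff]; fun_prop

@[fun_prop] theorem update {κ : Type*} [DecidableEq κ] (k : κ) {f : X → κ → Y}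
    {g : X → Y} (hf : Dm R f) (hg : Dm R g) : Dm R fun x => Function.update (f x) k (g x) := by
  refine pi fun j => ?_
  by_cases hj : j = k
  · subst hj; simpa using hg
  · simpa [hj] using (apply j).comp hf

@[fun_prop] theorem cons {n : ℕ} {f : X → Y} {g : X → Fin n → Y} (hf : Dm R f) (hg : Dm R g) :
    Dm R fun x => (Fin.cons (f x) (g x) : Fin (n + 1) → Y) := by
  refine pi fun j => ?_
  refine Fin.cases ?_ (fun i => ?_) j
  · simpa using hf
  · simpa using (apply i).comp hg

section Topology

variable [TopologicalSpace R] [OrderTopology R]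

@[fun_prop] theorem eventually_nhdsGT [NoMaxOrder R] {f : X → R} {P : X → R → Prop} (hf : Dm R f)
    (hP : Dm R fun p : X × R => P p.1 p.2) : Dm R fun x => ∀ᶠ y in 𝓝[>] (f x), P x y := by
  have h : ∀ x, (∀ᶠ y in 𝓝[>] (f x), P x y) ↔
      ∃ b, f x < b ∧ ¬ ∃ y, (f x < y ∧ y < b) ∧ ¬ P x y := fun x => by
    rw [Filter.Eventually, mem_nhdsGT_iff_exists_Ioo_subset]
    simp [Set.subset_def]
  simp only [h]
  fun_prop

@[fun_prop] theorem eventually_nhdsLT [NoMinOrder R] {f : X → R} {P : X → R → Prop} (hf : Dm R f)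
    (hP : Dm R fun p : X × R => P p.1 p.2) : Dm R fun x => ∀ᶠ y in 𝓝[<] (f x), P x y := by
  have h : ∀ x, (∀ᶠ y in 𝓝[<] (f x), P x y) ↔
      ∃ b, b < f x ∧ ¬ ∃ y, (b < y ∧ y < f x) ∧ ¬ P x y := fun x => by
    rw [Filter.Eventually, mem_nhdsLT_iff_exists_Ioo_subset]
    simp [Set.subset_def]
  simp only [h]
  fun_prop

@[fun_prop] theorem eventually_nhds [NoMaxOrder R] [NoMinOrder R] {f : X → R} {P : X → R → Prop}
    (hf : Dm R f) (hP : Dm R fun p : X × R => P p.1 p.2) :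
    Dm R fun x => ∀ᶠ y in 𝓝 (f x), P x y := by
  have h : ∀ x, (∀ᶠ y in 𝓝 (f x), P x y) ↔
      ∃ a b, (a < f x ∧ f x < b) ∧ ¬ ∃ y, (a < y ∧ y < b) ∧ ¬ P x y := fun x => by
    rw [Filter.Eventually, mem_nhds_iff_exists_Ioo_subset]
    simp [Set.subset_def]
  simp only [h]
  fun_prop

end Topology

end Dm


section OneVariable

variable [DenselyOrdered R] [NoMinOrder R] [NoMaxOrder R] [TopologicalSpace R] [OrderTopology R]

theorem Dm.exists_finite {P : R → Prop} (hP : Dm R P) : ∃ F : Set R, F.Finite ∧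
    ∀ x y, x < y → (∀ z ∈ F, z ∉ Icc x y) → (P x ↔ P y) :=
  OMinSystem.tame (hP (fun v : Unit → R => v ()) ⟨.inl (), fun _ => rfl⟩)

theorem Set.Finite.eventually_ne {F : Set R} (hF : F.Finite) (x : R) :
    ∃ a < x, ∃ b > x, ∀ y ∈ Ioo a b, y ≠ x → y ∉ F := by
  have : (F \ {x})ᶜ ∈ 𝓝 x := (hF.subset sdiff_subset).isClosed.isOpen_compl.mem_nhds (by simp)
  obtain ⟨a, b, hx, h⟩ := mem_nhds_iff_exists_Ioo_subset.1 this
  exact ⟨a, hx.1, b, hx.2, fun y hy hne hyF => h hy ⟨hyF, hne⟩⟩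

/-- A definable predicate is locally constant off a finite set. -/
theorem Dm.exists_finite_eventually_iff {P : R → Prop} (hP : Dm R P) :
    ∃ F : Set R, F.Finite ∧ ∀ x ∉ F, ∀ᶠ u in 𝓝 x, (P u ↔ P x) := by
  obtain ⟨F, hF, h⟩ := hP.exists_finite
  refine ⟨F, hF, fun x hx => ?_⟩
  obtain ⟨a, ha, b, hb, hab⟩ := hF.eventually_ne x
  filter_upwards [Ioo_mem_nhds ha hb] with u hu
  have key : ∀ z ∈ F, z ∉ Ioo a b := fun z hz hz' =>
    hab z hz' (fun e => hx (e ▸ hz)) hz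
  rcases lt_trichotomy u x with hux | rfl | hux
  · exact h _ _ hux fun z hz hz' => key z hz ⟨hu.1.trans_le hz'.1, hz'.2.trans_lt hb⟩
  · rfl
  · exact (h _ _ hux fun z hz hz' => key z hz ⟨ha.trans_le hz'.1, hz'.2.trans_lt hu.2⟩).symm

theorem Dm.eventually_nhdsGT_or {P : R → Prop} (hP : Dm R P) (x : R) :
    (∀ᶠ y in 𝓝[>] x, P y) ∨ ∀ᶠ y in 𝓝[>] x, ¬ P y := by
  obtain ⟨F, hF, h⟩ := hP.exists_finite
  obtain ⟨a, ha, b, hb, hab⟩ := hF.eventually_ne x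
  have key : ∀ y ∈ Ioo x b, ∀ y' ∈ Ioo x b, y < y' → (P y ↔ P y') := fun y hy y' hy' hlt =>
    h _ _ hlt fun z hz hz' => hab z ⟨ha.trans (hy.1.trans_le hz'.1), hz'.2.trans_lt hy'.2⟩
      (hy.1.trans_le hz'.1).ne' hz
  obtain ⟨y₀, hy₀⟩ := exists_between hb
  have key' : ∀ y ∈ Ioo x b, (P y ↔ P y₀) := fun y hy => by
    rcases lt_trichotomy y y₀ with hlt | rfl | hlt
    exacts [key _ hy _ hy₀ hlt, Iff.rfl, (key _ hy₀ _ hy hlt).symm]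
  by_cases h₀ : P y₀
  · left; filter_upwards [Ioo_mem_nhdsGT hb] with y hy using (key' y hy).2 h₀
  · right; filter_upwards [Ioo_mem_nhdsGT hb] with y hy using fun hh => h₀ ((key' y hy).1 hh)

theorem Dm.eventually_nhdsLT_or {P : R → Prop} (hP : Dm R P) (x : R) :
    (∀ᶠ y in 𝓝[<] x, P y) ∨ ∀ᶠ y in 𝓝[<] x, ¬ P y := by
  obtain ⟨F, hF, h⟩ := hP.exists_finite
  obtain ⟨a, ha, b, hb, hab⟩ := hF.eventually_ne x
  have key : ∀ y ∈ Ioo a x, ∀ y' ∈ Ioo a x, y < y' → (P y ↔ P y') := fun y hy y' hy' hlt =>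
    h _ _ hlt fun z hz hz' => hab z ⟨hy.1.trans_le hz'.1, (hz'.2.trans_lt hy'.2).trans hb⟩
      (hz'.2.trans_lt hy'.2).ne hz
  obtain ⟨y₀, hy₀⟩ := exists_between ha
  have key' : ∀ y ∈ Ioo a x, (P y ↔ P y₀) := fun y hy => by
    rcases lt_trichotomy y y₀ with hlt | rfl | hlt
    exacts [key _ hy _ hy₀ hlt, Iff.rfl, (key _ hy₀ _ hy hlt).symm]
  by_cases h₀ : P y₀
  · left; filter_upwards [Ioo_mem_nhdsLT ha] with y hy using (key' y hy).2 h₀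
  · right; filter_upwards [Ioo_mem_nhdsLT ha] with y hy using fun hh => h₀ ((key' y hy).1 hh)

/-- Intervals are definably connected. -/
theorem Dm.iff_of_forall_eventually_iff {P : R → Prop} (hP : Dm R P) {x y : R} (hxy : x ≤ y)
    (hloc : ∀ w ∈ Icc x y, ∀ᶠ u in 𝓝 w, (P u ↔ P w)) : P x ↔ P y := by
  obtain ⟨F, hF, h⟩ := hP.exists_finite
  induction hn : (F ∩ Icc x y).ncard using Nat.strong_induction_on generalizing x y with
  | _ n ih =>
  subst hn
  rcases hxy.eq_or_lt with rfl | hlt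
  · rfl
  by_cases hne : (F ∩ Icc x y).Nonempty
  swap
  · exact h x y hlt fun z hz hz' => hne ⟨z, hz, hz'⟩
  obtain ⟨c, hcF, hc⟩ := hne
  have step : ∀ x' y', x ≤ x' → x' ≤ y' → y' ≤ y → c ∉ Icc x' y' → (P x' ↔ P y') :=
    fun x' y' h1 h2 h3 h4 => by
      refine ih _ ?_ h2 (fun w hw => hloc w ⟨h1.trans hw.1, hw.2.trans h3⟩) rfl
      refine Set.ncard_lt_ncard ⟨?_, ?_⟩ (hF.inter_of_left _)
      · exact inter_subset_inter_right _ (Icc_subset_Icc h1 h3)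
      · exact fun hs => h4 (hs ⟨hcF, hc⟩).2
  obtain ⟨a, b, hcab, hab⟩ := mem_nhds_iff_exists_Ioo_subset.1 (hloc c hc)
  have h1 : P x ↔ P c := by
    rcases hc.1.eq_or_lt with rfl | hxc
    · rfl
    obtain ⟨w, hw1, hw2⟩ := exists_between (max_lt hcab.1 hxc)
    have hw := max_lt_iff.1 hw1
    exact (step x w le_rfl hw.2.le (hw2.le.trans hc.2) fun hh => hw2.not_ge hh.2).trans
      (hab ⟨hw.1, hw2.trans hcab.2⟩)
  have h2 : P y ↔ P c := by
    rcases hc.2.eq_or_lt with rfl | hcy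
    · rfl
    obtain ⟨w, hw1, hw2⟩ := exists_between (lt_min hcab.2 hcy)
    have hw := lt_min_iff.1 hw2
    exact (step w y (hc.1.trans hw1.le) hw.2.le le_rfl fun hh => hw1.not_ge hh.1).symm.trans
      (hab ⟨hcab.1.trans hw1, hw.1⟩)
  exact h1.trans h2.symm

theorem Dm.exists_not_eventually_iff {P : R → Prop} (hP : Dm R P) {x y : R} (hxy : x ≤ y)
    (h : ¬ (P x ↔ P y)) : ∃ w ∈ Icc x y, ¬ ∀ᶠ u in 𝓝 w, (P u ↔ P w) := by
  by_contra! hc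
  exact h (hP.iff_of_forall_eventually_iff hxy hc)

theorem Dm.exists_Ioo_or {P : R → Prop} (hP : Dm R P) {a b : R} (hab : a < b) :
    ∃ a' b', a ≤ a' ∧ a' < b' ∧ b' ≤ b ∧ ((∀ x ∈ Ioo a' b', P x) ∨ ∀ x ∈ Ioo a' b', ¬ P x) := by
  obtain ⟨F, hF, h⟩ := hP.exists_finite_eventually_iff
  obtain ⟨x, hx, hxF⟩ := (Ioo_infinite hab).exists_notMem_finite hF
  obtain ⟨a', b', hx', h'⟩ := mem_nhds_iff_exists_Ioo_subset.1
    (inter_mem (h x hxF) (Ioo_mem_nhds hx.1 hx.2))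
  refine ⟨max a a', min b b', le_max_left _ _, ?_, min_le_left _ _, ?_⟩
  · exact (max_lt hx.1 hx'.1).trans (lt_min hx.2 hx'.2)
  have key : ∀ y ∈ Ioo (max a a') (min b b'), (P y ↔ P x) := fun y hy =>
    (h' ⟨(le_max_right _ _).trans_lt hy.1, hy.2.trans_le (min_le_right _ _)⟩).1
  by_cases hPx : P x
  · exact .inl fun y hy => (key y hy).2 hPx
  · exact .inr fun y hy hh => hPx ((key y hy).1 hh)

theorem Dm.exists_Ioo_of_infinite {P : R → Prop} (hP : Dm R P) (hinf : {x | P x}.Infinite) :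
    ∃ a b, a < b ∧ ∀ x ∈ Ioo a b, P x := by
  obtain ⟨F, hF, h⟩ := hP.exists_finite_eventually_iff
  obtain ⟨x, hx, hxF⟩ := hinf.exists_notMem_finite hF
  obtain ⟨a', b', hx', h'⟩ := mem_nhds_iff_exists_Ioo_subset.1 (h x hxF)
  exact ⟨a', b', hx'.1.trans hx'.2, fun y hy => (h' hy).2 hx⟩

theorem Dm.exists_tail {Q : R → Prop} (hQ : Dm R Q) {c b : R}
    (hev : ∀ᶠ y in 𝓝[<] b, Q y) (hnot : ¬ ∀ y ∈ Ioo c b, Q y) :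
    ∃ d ∈ Ico c b, (∀ y ∈ Ioo d b, Q y) ∧ ¬ (Q d ∧ ∀ᶠ y in 𝓝[<] d, Q y) := by
  obtain ⟨w, hw, hwQ⟩ := mem_nhdsLT_iff_exists_Ioo_subset.1 hev
  have hT : Dm R fun w => ¬ ∃ y, (w < y ∧ y < b) ∧ ¬ Q y := by fun_prop
  have hTiff : ∀ w, (¬ ∃ y, (w < y ∧ y < b) ∧ ¬ Q y) ↔ ∀ y ∈ Ioo w b, Q y := fun w => by
    simp [mem_Ioo]
  simp only [hTiff] at hT
  have hcw : c < w := lt_of_not_ge fun hwc => hnot fun y hy => hwQ ⟨lt_of_le_of_lt hwc hy.1, hy.2⟩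
  obtain ⟨d, hd, hloc⟩ := hT.exists_not_eventually_iff hcw.le
    (fun h => hnot (h.2 fun y hy => hwQ hy))
  have hdb : d < b := hd.2.trans_lt hw
  have hdT : ∀ y ∈ Ioo d b, Q y := fun y hy => by
    by_contra hQy
    refine hloc ?_
    filter_upwards [Iio_mem_nhds hy.1] with u hu
    exact ⟨fun h => absurd (h y ⟨hu, hy.2⟩) hQy, fun h => absurd (h y hy) hQy⟩
  refine ⟨d, ⟨hd.1, hdb⟩, hdT, fun ⟨hQd, hleft⟩ => hloc ?_⟩
  obtain ⟨e, he, heQ⟩ := mem_nhdsLT_iff_exists_Ioo_subset.1 hleft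
  filter_upwards [Ioi_mem_nhds he] with u hu
  refine ⟨fun _ => hdT, fun _ y hy => ?_⟩
  rcases lt_trichotomy y d with hlt | rfl | hlt
  exacts [heQ ⟨lt_trans hu hy.1, hlt⟩, hQd, hdT y ⟨hlt, hy.2⟩]

end OneVariable


section Monotonicity

instance OMinSystem.dual : OMinSystem Rᵒᵈ where
  Dfn {ι} P := Dfn (R := R) (ι := ι) P
  top := top (R := R)
  and := and (R := R)
  not := not (R := R)
  ex := ex (R := R)
  subst := subst (R := R)
  lt := subst (R := R) (fun b => .inl !b) lt
  tame {P} h := by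
    obtain ⟨F, hF, hFP⟩ := tame (R := R) (P := P) h
    exact ⟨F, hF, fun x y hxy hz => (hFP y x hxy fun z hzF hz' => hz z hzF ⟨hz'.2, hz'.1⟩).symm⟩

variable [DenselyOrdered R] [NoMinOrder R] [NoMaxOrder R] [TopologicalSpace R] [OrderTopology R]
variable {C : Type*} [LinearOrder C] {f : R → C} {a b : R}

/-- A definable function all of whose points are strict local minima jumps down somewhere. -/
theorem exists_jump_of_local_min (hf : Dm R fun p : R × R => f p.1 < f p.2) (hab : a < b)
    (hR : ∀ x ∈ Ioo a b, ∀ᶠ y in 𝓝[>] x, f x < f y)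
    (hL : ∀ x ∈ Ioo a b, ∀ᶠ y in 𝓝[<] x, f x < f y) :
    ∃ v ∈ Ioo a b, ∃ c, (∀ᶠ y in 𝓝[<] v, f c < f y) ∧ ∀ᶠ z in 𝓝[>] v, f z ≤ f c := by
  have hlt : ∀ {g h : R → R}, Dm R g → Dm R h → Dm R fun x => f (g x) < f (h x) :=
    fun hg hh => hf.comp (hg.prodMk hh)
  have hB : Dm R fun x => ¬ ∃ y, (x < y ∧ y < b) ∧ ¬ f x < f y := by
    refine Dm.not (Dm.ex (Dm.and (by fun_prop) (Dm.not hf)))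
  rcases hB.eventually_nhdsLT_or b with hB' | hB'
  all_goals obtain ⟨w, hw, hwB⟩ := mem_nhdsLT_iff_exists_Ioo_subset.1 hB'
  · obtain ⟨x, hx1, hx2⟩ := exists_between (max_lt hab hw)
    have hx := max_lt_iff.1 hx1
    obtain ⟨y, hy, hy'⟩ := ((hL x ⟨hx.1, hx2⟩).and (Ioo_mem_nhdsLT hx.2)).exists
    exact absurd ⟨x, ⟨hy'.2, hx2⟩, hy.le.not_gt⟩ (hwB ⟨hy'.1, hy'.2.trans hx2⟩)
  obtain ⟨c, hc1, hcb⟩ := exists_between (max_lt hab hw)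
  have hc := max_lt_iff.1 hc1
  rcases (hlt (Dm.const c) Dm.id').eventually_nhdsLT_or b with hQ | hQ
  · exfalso
    have hnot : ¬ ∀ y ∈ Ioo c b, f c < f y := fun h =>
      hwB ⟨hc.2, hcb⟩ fun ⟨y, hy, hy'⟩ => hy' (h y hy)
    obtain ⟨d, hd, hd1, hd2⟩ := (hlt (Dm.const c) Dm.id').exists_tail hQ hnot
    have hdc : f c < f d := by
      by_contra hcon
      exact hwB ⟨lt_of_lt_of_le hc.2 hd.1, hd.2⟩ fun ⟨y, hy, hy'⟩ =>
        hy' ((not_lt.1 hcon).trans_lt (hd1 y hy))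
    exact hd2 ⟨hdc, (hL d ⟨hc.1.trans_le hd.1, hd.2⟩).mono fun y hy => hdc.trans hy⟩
  · have hnot : ¬ ∀ y ∈ Ioo c b, ¬ f c < f y := fun h => by
      obtain ⟨y, hy, hy'⟩ := ((hR c ⟨hc.1, hcb⟩).and (Ioo_mem_nhdsGT hcb)).exists
      exact h y hy' hy
    obtain ⟨d, hd, hd1, hd2⟩ := (hlt (Dm.const c) Dm.id').not.exists_tail hQ hnot
    have hdI : d ∈ Ioo a b := ⟨hc.1.trans_le hd.1, hd.2⟩
    have hright : ∀ᶠ z in 𝓝[>] d, f z ≤ f c := by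
      filter_upwards [Ioo_mem_nhdsGT hd.2] with z hz using not_lt.1 (hd1 z hz)
    refine ⟨d, hdI, c, ?_, hright⟩
    have hdc : ¬ f c < f d := by
      obtain ⟨z, hz1, hz2⟩ := ((hR d hdI).and hright).exists
      exact (hz1.trans_le hz2).not_gt
    exact ((hlt (Dm.const c) Dm.id').eventually_nhdsLT_or d).resolve_right fun h => hd2 ⟨hdc, h⟩

theorem not_forall_local_min (hf : Dm R fun p : R × R => f p.1 < f p.2) (hab : a < b)
    (hR : ∀ x ∈ Ioo a b, ∀ᶠ y in 𝓝[>] x, f x < f y)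
    (hL : ∀ x ∈ Ioo a b, ∀ᶠ y in 𝓝[<] x, f x < f y) : False := by
  have hlt : ∀ {X : Type _} [DSpace R X] {g h : X → R}, Dm R g → Dm R h →
      Dm R fun x => f (g x) < f (h x) := fun hg hh => hf.comp (hg.prodMk hh)
  have hV : Dm R fun v => ∃ c, (∀ᶠ y in 𝓝[<] v, f c < f y) ∧ ∀ᶠ z in 𝓝[>] v, ¬ f c < f z := by
    refine Dm.ex (Dm.and (Dm.eventually_nhdsLT (by fun_prop) ?_)
      (Dm.eventually_nhdsGT (by fun_prop) (Dm.not ?_)))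
    all_goals exact hlt (by fun_prop) (by fun_prop)
  obtain ⟨a', b', ha, hab', hb, h⟩ := hV.exists_Ioo_or hab
  have hsub : ∀ {x}, x ∈ Ioo a' b' → x ∈ Ioo a b := fun hx =>
    ⟨ha.trans_lt hx.1, hx.2.trans_le hb⟩
  rcases h with h | h
  · have hfd : Dm Rᵒᵈ fun p : Rᵒᵈ × Rᵒᵈ => f (OrderDual.ofDual p.1) < f (OrderDual.ofDual p.2) := hf
    have hRd : ∀ x : Rᵒᵈ, x ∈ Ioo (OrderDual.toDual b') (OrderDual.toDual a') →
        ∀ᶠ y in 𝓝[>] x, f (OrderDual.ofDual x) < f (OrderDual.ofDual y) :=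
      fun x hx => hL (OrderDual.ofDual x) (hsub ⟨hx.2, hx.1⟩)
    have hLd : ∀ x : Rᵒᵈ, x ∈ Ioo (OrderDual.toDual b') (OrderDual.toDual a') →
        ∀ᶠ y in 𝓝[<] x, f (OrderDual.ofDual x) < f (OrderDual.ofDual y) :=
      fun x hx => hR (OrderDual.ofDual x) (hsub ⟨hx.2, hx.1⟩)
    obtain ⟨v, hv, c', hc1, hc2⟩ := exists_jump_of_local_min (R := Rᵒᵈ)
      (f := fun x : Rᵒᵈ => f (OrderDual.ofDual x)) hfd (OrderDual.toDual_lt_toDual.2 hab') hRd hLd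
    obtain ⟨c, h1, h2⟩ := h (OrderDual.ofDual v) ⟨hv.2, hv.1⟩
    have hc1' : ∀ᶠ y in 𝓝[>] (OrderDual.ofDual v), f (OrderDual.ofDual c') < f y := hc1
    have hc2' : ∀ᶠ y in 𝓝[<] (OrderDual.ofDual v), f y ≤ f (OrderDual.ofDual c') := hc2
    obtain ⟨y, hy1, hy2⟩ := (h1.and hc2').exists
    obtain ⟨z, hz1, hz2⟩ := (h2.and hc1').exists
    exact hz1 (hy1.trans_le (hy2.trans hz2.le))
  · obtain ⟨v, hv, c, h1, h2⟩ := exists_jump_of_local_min hf hab'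
      (fun x hx => hR x (hsub hx)) (fun x hx => hL x (hsub hx))
    exact h v hv ⟨c, h1, h2.mono fun _ h => h.not_gt⟩

theorem strictMonoOn_of_local (hf : Dm R fun p : R × R => f p.1 < f p.2)
    (hR : ∀ x ∈ Ioo a b, ∀ᶠ y in 𝓝[>] x, f x < f y)
    (hL : ∀ x ∈ Ioo a b, ∀ᶠ y in 𝓝[<] x, f y < f x) : StrictMonoOn f (Ioo a b) := by
  intro x hx y hy hxy
  have hQ : Dm R fun w => f w < f y := hf.comp (Dm.id'.prodMk (Dm.const y))
  obtain ⟨c, hac, hcx⟩ := exists_between hx.1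
  by_contra hcon
  obtain ⟨d, hd, hd1, hd2⟩ := hQ.exists_tail (c := c) (hL y hy) fun h => hcon (h x ⟨hcx, hxy⟩)
  have hdI : d ∈ Ioo a b := ⟨hac.trans_le hd.1, hd.2.trans hy.2⟩
  obtain ⟨z, hz1, hz2⟩ := ((hR d hdI).and (Ioo_mem_nhdsGT hd.2)).exists
  have hdy : f d < f y := hz1.trans (hd1 z hz2)
  exact hd2 ⟨hdy, (hL d hdI).mono fun w hw => hw.trans hdy⟩

/-- A definable function is constant or strictly monotone on some subinterval. -/
theorem exists_Ioo_monotoneOn_or_antitoneOn (hf : Dm R fun p : R × R => f p.1 < f p.2)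
    (hab : a < b) : ∃ a' b', a ≤ a' ∧ a' < b' ∧ b' ≤ b ∧
      (MonotoneOn f (Ioo a' b') ∨ AntitoneOn f (Ioo a' b')) := by
  have hf' : Dm R fun p : R × R => f p.2 < f p.1 := hf.comp (Dm.snd.prodMk Dm.fst)
  have hf₁ : Dm R fun p : R × R => (OrderDual.toDual ∘ f) p.1 < (OrderDual.toDual ∘ f) p.2 := hf'
  obtain ⟨a₁, b₁, ha₁, hab₁, hb₁, h₁⟩ :=
    (Dm.eventually_nhdsGT (P := fun x y => f x < f y) Dm.id' hf).exists_Ioo_or hab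
  obtain ⟨a₂, b₂, ha₂, hab₂, hb₂, h₂⟩ :=
    (Dm.eventually_nhdsGT (P := fun x y => f y < f x) Dm.id' hf').exists_Ioo_or hab₁
  obtain ⟨a₃, b₃, ha₃, hab₃, hb₃, h₃⟩ :=
    (Dm.eventually_nhdsLT (P := fun x y => f x < f y) Dm.id' hf).exists_Ioo_or hab₂
  obtain ⟨a₄, b₄, ha₄, hab₄, hb₄, h₄⟩ :=
    (Dm.eventually_nhdsLT (P := fun x y => f y < f x) Dm.id' hf').exists_Ioo_or hab₃
  have ha : a ≤ a₄ := ha₁.trans (ha₂.trans (ha₃.trans ha₄))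
  have hb : b₄ ≤ b := hb₄.trans (hb₃.trans (hb₂.trans hb₁))
  replace h₃ := h₃.imp (fun h x hx => h x (Ioo_subset_Ioo ha₄ hb₄ hx))
    (fun h x hx => h x (Ioo_subset_Ioo ha₄ hb₄ hx))
  replace h₂ := h₂.imp (fun h x hx => h x (Ioo_subset_Ioo (ha₃.trans ha₄) (hb₄.trans hb₃) hx))
    (fun h x hx => h x (Ioo_subset_Ioo (ha₃.trans ha₄) (hb₄.trans hb₃) hx))
  replace h₁ := h₁.imp (fun h x hx => h x (Ioo_subset_Ioo (ha₂.trans (ha₃.trans ha₄))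
    ((hb₄.trans hb₃).trans hb₂) hx)) (fun h x hx => h x
      (Ioo_subset_Ioo (ha₂.trans (ha₃.trans ha₄)) ((hb₄.trans hb₃).trans hb₂) hx))
  obtain ⟨x, hx⟩ := exists_between hab₄
  have hconst : ∀ {p q}, a₄ ≤ p → p < q → q ≤ b₄ → (∀ y ∈ Ioo p q, f y = f x) →
      ∃ a' b', a ≤ a' ∧ a' < b' ∧ b' ≤ b ∧
        (MonotoneOn f (Ioo a' b') ∨ AntitoneOn f (Ioo a' b')) := fun {p q} hp hpq hq h =>
    ⟨p, q, ha.trans hp, hpq, hq.trans hb, .inl fun y hy z hz _ => ((h y hy).trans (h z hz).symm).le⟩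
  have right : (∀ x ∈ Ioo a₄ b₄, ∀ᶠ y in 𝓝[>] x, f x < f y) ∨
      (∀ x ∈ Ioo a₄ b₄, ∀ᶠ y in 𝓝[>] x, f y < f x) ∨ ∀ᶠ y in 𝓝[>] x, f y = f x := by
    refine h₁.imp_right fun h1 => h₂.imp_right fun h2 => ?_
    have e1 := ((hf.comp ((Dm.const x).prodMk Dm.id')).eventually_nhdsGT_or x).resolve_left (h1 x hx)
    have e2 := ((hf'.comp ((Dm.const x).prodMk Dm.id')).eventually_nhdsGT_or x).resolve_left (h2 x hx)
    filter_upwards [e1, e2] with y h1 h2 using le_antisymm (not_lt.1 h1) (not_lt.1 h2)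
  have left : (∀ x ∈ Ioo a₄ b₄, ∀ᶠ y in 𝓝[<] x, f x < f y) ∨
      (∀ x ∈ Ioo a₄ b₄, ∀ᶠ y in 𝓝[<] x, f y < f x) ∨ ∀ᶠ y in 𝓝[<] x, f y = f x := by
    refine h₃.imp_right fun h1 => h₄.imp_right fun h2 => ?_
    have e1 := ((hf.comp ((Dm.const x).prodMk Dm.id')).eventually_nhdsLT_or x).resolve_left (h1 x hx)
    have e2 := ((hf'.comp ((Dm.const x).prodMk Dm.id')).eventually_nhdsLT_or x).resolve_left (h2 x hx)
    filter_upwards [e1, e2] with y h1 h2 using le_antisymm (not_lt.1 h1) (not_lt.1 h2)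
  rcases right with hR | hR | hR
  · rcases left with hL | hL | hL
    · exact (not_forall_local_min hf hab₄ hR hL).elim
    · exact ⟨a₄, b₄, ha, hab₄, hb, .inl (strictMonoOn_of_local hf hR hL).monotoneOn⟩
    · obtain ⟨w, hw, hwx⟩ := mem_nhdsLT_iff_exists_Ioo_subset.1
        (inter_mem hL (Ioo_mem_nhdsLT hx.1))
      exact hconst (le_max_left a₄ w) (max_lt hx.1 hw) hx.2.le
        fun y hy => (hwx ⟨(le_max_right _ _).trans_lt hy.1, hy.2⟩).1
  · rcases left with hL | hL | hL
    · exact ⟨a₄, b₄, ha, hab₄, hb, .inr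
        (strictMonoOn_of_local (f := OrderDual.toDual ∘ f) hf₁ hR hL).monotoneOn⟩
    · exact (not_forall_local_min (f := OrderDual.toDual ∘ f) hf₁ hab₄ hR hL).elim
    · obtain ⟨w, hw, hwx⟩ := mem_nhdsLT_iff_exists_Ioo_subset.1
        (inter_mem hL (Ioo_mem_nhdsLT hx.1))
      exact hconst (le_max_left a₄ w) (max_lt hx.1 hw) hx.2.le
        fun y hy => (hwx ⟨(le_max_right _ _).trans_lt hy.1, hy.2⟩).1
  · obtain ⟨w, hw, hwx⟩ := mem_nhdsGT_iff_exists_Ioo_subset.1 hR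
    exact hconst hx.1.le (lt_min hx.2 hw) (min_le_left b₄ w)
      fun y hy => hwx ⟨hy.1, hy.2.trans_le (min_le_right _ _)⟩

end Monotonicity


theorem eventually_nhds_of_lt_of_gt {α : Type*} [LinearOrder α] [TopologicalSpace α]
    {P : α → Prop} {x : α} (hx : P x)
    (hlt : ∀ᶠ u in 𝓝[<] x, P u) (hgt : ∀ᶠ u in 𝓝[>] x, P u) : ∀ᶠ u in 𝓝 x, P u := by
  have h : ∀ᶠ u in 𝓝[≠] x, P u := by
    rw [← nhdsLT_sup_nhdsGT, eventually_sup]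
    exact ⟨hlt, hgt⟩
  rw [eventually_nhdsWithin_iff] at h
  filter_upwards [h] with u hu
  by_cases hux : u = x
  · exact hux ▸ hx
  · exact hu hux

section Gap

variable [DenselyOrdered R] [NoMinOrder R] [NoMaxOrder R] [TopologicalSpace R] [OrderTopology R]
variable {a b : R}

/-- There is no definable family of pairwise disjoint sets with nonempty interior
indexed by an interval. -/
theorem not_pairwise_disjoint_of_Ioo_subset {G : R → R → Prop}
    (hG : Dm R fun p : R × R => G p.1 p.2) (hab : a < b)
    (hdisj : ∀ t ∈ Ioo a b, ∀ t' ∈ Ioo a b, ∀ w, G t w → G t' w → t = t')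
    (hIoo : ∀ t ∈ Ioo a b, ∃ p q, p < q ∧ ∀ w ∈ Ioo p q, G t w) : False := by
  obtain ⟨U, hU⟩ : ∃ U : R → R → Prop, ∀ t w, U t w ↔ ∀ᶠ u in 𝓝 w, G t u := ⟨_, fun _ _ => Iff.rfl⟩
  have hUd : Dm R fun p : R × R => U p.1 p.2 := by simp only [hU]; fun_prop
  have hUG : ∀ {t w}, U t w → G t w := fun h => ((hU _ _).1 h).self_of_nhds
  have hUo : ∀ {t w}, U t w → ∀ᶠ u in 𝓝 w, U t u := fun h => by
    simp only [hU] at h ⊢; exact h.eventually_nhds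
  have hUc : ∀ {t w}, U t w → ∀ᶠ u in 𝓝 w, (U t u ↔ U t w) := fun h =>
    (hUo h).mono fun _ hu => iff_of_true hu h
  have hAd : Dm R fun w => ∃ t, (a < t ∧ t < b) ∧ ¬ ∀ᶠ u in 𝓝 w, (U t u ↔ U t w) := by fun_prop
  obtain ⟨F, hF, hAF⟩ := hAd.exists_finite_eventually_iff
  have key : ∀ t ∈ Ioo a b, ∀ w, (¬ ∀ᶠ u in 𝓝 w, (U t u ↔ U t w)) → w ∈ F := by
    intro t ht w htw
    by_contra hwF
    have hnw : ¬ U t w := fun h => htw (hUc h)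
    obtain ⟨v, hv, hAv⟩ : ∃ v, U t v ∧ ∃ t, (a < t ∧ t < b) ∧ ¬ ∀ᶠ u in 𝓝 v, (U t u ↔ U t v) := by
      by_contra! hcon
      refine htw ?_
      filter_upwards [hAF w hwF] with u hu
      refine iff_of_false (fun hut => ?_) hnw
      obtain ⟨t', ht', h'⟩ := hu.2 ⟨t, ht, htw⟩
      exact h' (hcon u hut t' ht')
    obtain ⟨t', ht', h'⟩ := hAv
    by_cases htt : t' = t
    · subst htt; exact h' (hUc hv)
    · refine h' ?_
      have hno : ∀ u, U t u → ¬ U t' u := fun u h1 h2 =>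
        htt (hdisj t' ht' t ht u (hUG h2) (hUG h1))
      filter_upwards [hUo hv] with u hu using iff_of_false (hno u hu) (hno v hv)
  have hex : ∀ t ∈ Ioo a b, ∃ z, U t z := by
    intro t ht
    obtain ⟨p, q, hpq, h⟩ := hIoo t ht
    obtain ⟨z, hz⟩ := exists_between hpq
    exact ⟨z, (hU _ _).2 (by filter_upwards [Ioo_mem_nhds hz.1 hz.2] with w hw using h w hw)⟩
  obtain ⟨t₁, ht₁⟩ := exists_between hab
  obtain ⟨z₁, hz₁⟩ := hex t₁ ht₁
  have hsub : Ioo a b ⊆ {t₁} ∪ ⋃ w ∈ F, ({t | t ∈ Ioo a b ∧ ∀ᶠ u in 𝓝[<] w, U t u} ∪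
      {t | t ∈ Ioo a b ∧ ∀ᶠ u in 𝓝[>] w, U t u}) := by
    intro t ht
    by_cases htt : t = t₁
    · exact .inl htt
    right
    have hz₁' : ¬ U t z₁ := fun h => htt (hdisj t ht t₁ ht₁ z₁ (hUG h) (hUG hz₁))
    obtain ⟨z, hz⟩ := hex t ht
    have hUt : Dm R fun w => U t w := by fun_prop
    obtain ⟨w, hw⟩ : ∃ w, ¬ ∀ᶠ u in 𝓝 w, (U t u ↔ U t w) := by
      rcases le_total z z₁ with h | h
      · obtain ⟨w, -, hw⟩ := hUt.exists_not_eventually_iff h (by tauto)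
        exact ⟨w, hw⟩
      · obtain ⟨w, -, hw⟩ := hUt.exists_not_eventually_iff h (by tauto)
        exact ⟨w, hw⟩
    have hnw : ¬ U t w := fun h => hw (hUc h)
    refine mem_biUnion (key t ht w hw) ?_
    rcases hUt.eventually_nhdsLT_or w with hl | hl
    · exact .inl ⟨ht, hl⟩
    rcases hUt.eventually_nhdsGT_or w with hr | hr
    · exact .inr ⟨ht, hr⟩
    exact absurd ((eventually_nhds_of_lt_of_gt (P := fun u => ¬ U t u) hnw hl hr).mono
      fun _ hu => iff_of_false hu hnw) hw
  refine (Ioo_infinite hab) (Finite.subset ((finite_singleton _).union (hF.biUnion fun w _ =>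
    Finite.union (Subsingleton.finite ?_) (Subsingleton.finite ?_))) hsub)
  all_goals
    rintro t ⟨ht, h⟩ t' ⟨ht', h'⟩
    obtain ⟨u, hu, hu'⟩ := (h.and h').exists
    exact hdisj t ht t' ht' u (hUG hu) (hUG hu')

end Gap


section Continuity

variable [DenselyOrdered R] [NoMinOrder R] [NoMaxOrder R] [TopologicalSpace R] [OrderTopology R]

/-- Continuity at `t` of a family `D` of lower sets. -/
def CutContinuousAt (D : R → R → Prop) (t : R) : Prop :=
  (∀ z z', z < z' → D t z' → ∀ᶠ u in 𝓝 t, D u z) ∧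
    ∀ z z', z < z' → ¬ D t z → ∀ᶠ u in 𝓝 t, ¬ D u z'

theorem eq_of_not_eventually_iff_of_monotone {P : R → Prop} {a b t t' : R}
    (hP : ∀ u ∈ Ioo a b, ∀ v ∈ Ioo a b, u ≤ v → P u → P v) (ht : t ∈ Ioo a b) (ht' : t' ∈ Ioo a b)
    (h : ¬ ∀ᶠ u in 𝓝 t, (P u ↔ P t)) (h' : ¬ ∀ᶠ u in 𝓝 t', (P u ↔ P t')) : t = t' := by
  wlog hlt : t < t' generalizing t t'
  · rcases (not_lt.1 hlt).eq_or_lt with e | e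
    · exact e.symm
    · exact (this ht' ht h' h e).symm
  exfalso
  by_cases hu : ∃ u ∈ Ioo a t', P u
  · obtain ⟨u, hu, hPu⟩ := hu
    have huab : u ∈ Ioo a b := ⟨hu.1, hu.2.trans ht'.2⟩
    refine h' ?_
    filter_upwards [Ioo_mem_nhds hu.2 ht'.2] with v hv
    exact iff_of_true (hP u huab v ⟨hu.1.trans hv.1, hv.2⟩ hv.1.le hPu) (hP u huab t' ht' hu.2.le hPu)
  · push Not at hu
    refine h ?_
    filter_upwards [Ioo_mem_nhds ht.1 hlt] with v hv
    exact iff_of_false (hu v hv) (hu t ⟨ht.1, hlt⟩)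

open Classical in
/-- A definable family of lower sets is continuous off a finite set. -/
theorem finite_not_cutContinuousAt {D : R → R → Prop} (hD : Dm R fun p : R × R => D p.1 p.2)
    (hlow : ∀ t z z', z ≤ z' → D t z' → D t z) : {t | ¬ CutContinuousAt D t}.Finite := by
  by_contra hinf
  have hC : Dm R fun t => ¬ CutContinuousAt D t := by
    refine Dm.not (Dm.and ?_ ?_)
    all_goals
      refine Dm.all (Dm.all (Dm.imp ?_ (Dm.imp ?_ ?_)))
      all_goals fun_prop
  obtain ⟨a, b, hab, hCab⟩ := hC.exists_Ioo_of_infinite hinf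
  let f : R → LowerSet R := fun t => ⟨{z | D t z}, fun z' z hz h => hlow t z z' hz h⟩
  have hfle : ∀ s t, f s ≤ f t ↔ ∀ z, D s z → D t z := fun s t => Iff.rfl
  have hflt : ∀ s t, f s < f t ↔ ∃ z, D t z ∧ ¬ D s z := fun s t => by
    rw [← not_le, hfle]; push Not; rfl
  have hf : Dm R fun p : R × R => f p.1 < f p.2 := by simp only [hflt]; fun_prop
  obtain ⟨a', b', ha, hab', hb, hmon⟩ := exists_Ioo_monotoneOn_or_antitoneOn hf hab
  refine not_pairwise_disjoint_of_Ioo_subset (G := fun t w => ¬ ∀ᶠ u in 𝓝 t, (D u w ↔ D t w))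
    (by fun_prop) hab' ?_ ?_
  · intro t ht t' ht' w h h'
    rcases hmon with hmon | hmon
    · exact eq_of_not_eventually_iff_of_monotone (P := fun u => D u w)
        (fun u hu v hv huv hPu => hmon hu hv huv hPu) ht ht' h h'
    · exact eq_of_not_eventually_iff_of_monotone (P := fun u => ¬ D u w)
        (fun u hu v hv huv hPu hPv => hPu (hmon hu hv huv hPv)) ht ht'
        (by simpa only [not_iff_not] using h) (by simpa only [not_iff_not] using h')
  · intro t ht
    have hnc := hCab t ⟨ha.trans_lt ht.1, ht.2.trans_le hb⟩
    rw [CutContinuousAt, not_and_or] at hnc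
    push Not at hnc
    rcases hnc with ⟨z, z', hz, h1, h2⟩ | ⟨z, z', hz, h1, h2⟩
    · refine ⟨z, z', hz, fun w hw hc => (not_eventually.2 h2) ?_⟩
      filter_upwards [hc] with u hu
      exact hlow u z w hw.1.le (hu.2 (hlow t w z' hw.2.le h1))
    · refine ⟨z, z', hz, fun w hw hc => (not_eventually.2 (h2.mono fun _ h => not_not.2 h)) ?_⟩
      filter_upwards [hc] with u hu
      exact fun hz' => h1 (hlow t z w hw.1.le (hu.1 (hlow u w z' hw.2.le hz')))

end Continuity


section Counting

theorem Set.Finite.succ_le_ncard_iff {α : Type*} [LinearOrder α] {S : Set α} (hS : S.Finite)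
    {j : ℕ} : j + 1 ≤ S.ncard ↔ ∃ s ∈ S, j ≤ {y | y ∈ S ∧ y < s}.ncard := by
  have hfin : ∀ s, {y | y ∈ S ∧ y < s}.Finite := fun s => hS.subset fun y hy => hy.1
  constructor
  · intro h
    have hne : S.Nonempty := nonempty_of_ncard_ne_zero (by lia)
    obtain ⟨s, hs, hmax⟩ := hS.exists_maximal hne
    refine ⟨s, hs, ?_⟩
    have : S = insert s {y | y ∈ S ∧ y < s} := by
      ext y
      simp only [mem_insert_iff, mem_ofPred_eq]
      constructor
      · intro hy
        rcases lt_or_ge y s with h | h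
        · exact .inr ⟨hy, h⟩
        · exact .inl (le_antisymm (hmax hy h) h)
      · rintro (rfl | h)
        · exact hs
        · exact h.1
    rw [this, ncard_insert_of_notMem (by simp) (hfin s)] at h
    lia
  · rintro ⟨s, hs, h⟩
    have : insert s {y | y ∈ S ∧ y < s} ⊆ S := by
      rintro y (rfl | h)
      · exact hs
      · exact h.1
    have := ncard_le_ncard this hS
    rw [ncard_insert_of_notMem (by simp) (hfin s)] at this
    lia

variable {Y : X → R → Prop}

theorem Dm.le_ncard_lt (hY : Dm R fun p : X × R => Y p.1 p.2) (hfin : ∀ x, {y | Y x y}.Finite)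
    (j : ℕ) : Dm R fun p : X × R => j ≤ {y | Y p.1 y ∧ y < p.2}.ncard := by
  induction j with
  | zero => simpa using Dm.const True
  | succ j ih =>
    have h : ∀ p : X × R, j + 1 ≤ {y | Y p.1 y ∧ y < p.2}.ncard ↔
        ∃ s, (Y p.1 s ∧ s < p.2) ∧ j ≤ {y | Y p.1 y ∧ y < s}.ncard := fun p => by
      rw [Set.Finite.succ_le_ncard_iff ((hfin p.1).subset fun y hy => hy.1)]
      refine exists_congr fun s => and_congr_right fun hs => ?_
      have : {y | y ∈ {y | Y p.1 y ∧ y < p.2} ∧ y < s} = {y | Y p.1 y ∧ y < s} := by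
        ext y
        exact ⟨fun h => ⟨h.1.1, h.2⟩, fun h => ⟨⟨h.1, h.2.trans hs.2⟩, h.2⟩⟩
      rw [this]
    simp only [h]
    refine Dm.ex (Dm.and (by fun_prop) ?_)
    exact ih.comp (f := fun p : X × R => j ≤ {y | Y p.1 y ∧ y < p.2}.ncard)
      (g := fun p : (X × R) × R => (p.1.1, p.2)) (by fun_prop)

theorem Dm.le_ncard (hY : Dm R fun p : X × R => Y p.1 p.2) (hfin : ∀ x, {y | Y x y}.Finite)
    (j : ℕ) : Dm R fun x => j ≤ {y | Y x y}.ncard := by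
  cases j with
  | zero => simpa using Dm.const True
  | succ j =>
    simp only [(hfin _).succ_le_ncard_iff, mem_ofPred_eq]
    exact Dm.ex (Dm.and (by fun_prop) (Dm.le_ncard_lt hY hfin j))

theorem Dm.ncard_lt_eq (hY : Dm R fun p : X × R => Y p.1 p.2) (hfin : ∀ x, {y | Y x y}.Finite)
    (j : ℕ) : Dm R fun p : X × R => {y | Y p.1 y ∧ y < p.2}.ncard = j := by
  have h : ∀ n : ℕ, n = j ↔ j ≤ n ∧ ¬ j + 1 ≤ n := by lia
  simp only [h]
  exact (Dm.le_ncard_lt hY hfin j).and (Dm.le_ncard_lt hY hfin (j + 1)).not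

end Counting

section Good

variable [DenselyOrdered R] [NoMinOrder R] [NoMaxOrder R] [TopologicalSpace R] [OrderTopology R]

/-- The fibre of `Y` over `u` has exactly one point in `[p, q]`, and that point lies in
`(p, q)`. -/
def UniqueIn (Y : R → R → Prop) (p q u : R) : Prop :=
  ∃ y, (p < y ∧ y < q) ∧ ∀ y', p ≤ y' → y' ≤ q → (Y u y' ↔ y' = y)

/-- The point `s` is isolated by some interval `[p, q]` in the fibre of `Y` over `t`, but not
uniformly so for nearby fibres. -/
def BadPoint (Y : R → R → Prop) (t s : R) : Prop :=
  Y t s ∧ ∃ p q, (p < s ∧ s < q) ∧ (∀ y, p ≤ y → y ≤ q → (Y t y ↔ y = s)) ∧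
    ¬ ∀ᶠ u in 𝓝 t, UniqueIn Y p q u

/-- The fibres of `Y` vary continuously near `t`. -/
structure GoodAt (Y : R → R → Prop) (t : R) : Prop where
  bot : ∀ q, (∀ y, y ≤ q → ¬ Y t y) → ∀ᶠ u in 𝓝 t, ∀ y, y ≤ q → ¬ Y u y
  top : ∀ q, (∀ y, q ≤ y → ¬ Y t y) → ∀ᶠ u in 𝓝 t, ∀ y, q ≤ y → ¬ Y u y
  mid : ∀ s, ¬ BadPoint Y t s

theorem Dm.badPoint {Y : X → R → R → Prop} (hY : Dm R fun p : X × R × R => Y p.1 p.2.1 p.2.2)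
    {f g : X → R} (hf : Dm R f) (hg : Dm R g) : Dm R fun x => BadPoint (Y x) (f x) (g x) := by
  refine Dm.and (by fun_prop) (Dm.ex (Dm.ex (Dm.and (by fun_prop) (Dm.and (Dm.all
    (Dm.imp (by fun_prop) (Dm.imp (by fun_prop) (by fun_prop)))) (Dm.not
      (Dm.eventually_nhds (by fun_prop) (Dm.ex (Dm.and (by fun_prop)
        (Dm.all (Dm.imp (by fun_prop) (Dm.imp (by fun_prop) (by fun_prop))))))))))))

theorem goodAt_iff {Y : R → R → Prop} {t : R} : GoodAt Y t ↔
    (∀ q, (∀ y, y ≤ q → ¬ Y t y) → ∀ᶠ u in 𝓝 t, ∀ y, y ≤ q → ¬ Y u y) ∧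
    (∀ q, (∀ y, q ≤ y → ¬ Y t y) → ∀ᶠ u in 𝓝 t, ∀ y, q ≤ y → ¬ Y u y) ∧
    ∀ s, ¬ BadPoint Y t s :=
  ⟨fun h => ⟨h.1, h.2, h.3⟩, fun h => ⟨h.1, h.2.1, h.2.2⟩⟩

theorem Dm.goodAt {Y : X → R → R → Prop} (hY : Dm R fun p : X × R × R => Y p.1 p.2.1 p.2.2)
    {f : X → R} (hf : Dm R f) : Dm R fun x => GoodAt (Y x) (f x) := by
  simp only [goodAt_iff]
  refine Dm.and ?_ (Dm.and ?_ (Dm.all (Dm.not (Dm.badPoint (Y := fun p : X × R => Y p.1)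
    (by fun_prop) (by fun_prop) (by fun_prop)))))
  all_goals exact Dm.all (Dm.imp (Dm.all (Dm.imp (by fun_prop) (by fun_prop)))
    (Dm.eventually_nhds (by fun_prop) (Dm.all (Dm.imp (by fun_prop) (by fun_prop)))))

theorem Set.Finite.exists_gt_forall_lt {S : Set R} (hS : S.Finite) (q : R) :
    ∃ z > q, ∀ y ∈ S, q < y → z < y := by
  have : ∀ᶠ z in 𝓝[>] q, ∀ y ∈ S, q < y → z < y :=
    (eventually_all_finite hS).2 fun y _ => by
      by_cases h : q < y
      · filter_upwards [Ioo_mem_nhdsGT h] with z hz _ using hz.2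
      · exact .of_forall fun z h' => absurd h' h
  obtain ⟨z, hz, hzq⟩ := (this.and self_mem_nhdsWithin).exists
  exact ⟨z, hzq, hz⟩

theorem Set.Finite.exists_lt_forall_lt {S : Set R} (hS : S.Finite) (q : R) :
    ∃ z < q, ∀ y ∈ S, y < q → y < z := by
  have : ∀ᶠ z in 𝓝[<] q, ∀ y ∈ S, y < q → y < z :=
    (eventually_all_finite hS).2 fun y _ => by
      by_cases h : y < q
      · filter_upwards [Ioo_mem_nhdsLT h] with z hz _ using hz.1
      · exact .of_forall fun z h' => absurd h' h
  obtain ⟨z, hz, hzq⟩ := (this.and self_mem_nhdsWithin).exists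
  exact ⟨z, hzq, hz⟩

variable {Y : R → R → Prop}

theorem finite_badPoint (hY : Dm R fun p : R × R => Y p.1 p.2) (hfin : ∀ t, {y | Y t y}.Finite) :
    {t | ∃ s, BadPoint Y t s}.Finite := by
  by_contra hinf
  have hB : Dm R fun p : R × R => BadPoint Y p.1 p.2 :=
    Dm.badPoint (Y := fun _ => Y) (by fun_prop) (by fun_prop) (by fun_prop)
  obtain ⟨a, b, hab, hBad⟩ := (Dm.ex hB).exists_Ioo_of_infinite hinf
  obtain ⟨S, hS⟩ : ∃ S : R → R → Prop, ∀ t s, S t s ↔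
    BadPoint Y t s ∧ ∀ s', s' < s → ¬ BadPoint Y t s' := ⟨_, fun _ _ => Iff.rfl⟩
  have hSd : Dm R fun p : R × R => S p.1 p.2 := by
    simp only [hS]
    exact Dm.and hB (Dm.all (Dm.imp (by fun_prop) (by fun_prop)))
  have hSu : ∀ {t s s'}, S t s → S t s' → s = s' := fun {t s s'} h h' => by
    rw [hS] at h h'
    rcases lt_trichotomy s s' with hlt | rfl | hlt
    · exact absurd h.1 (h'.2 _ hlt)
    · rfl
    · exact absurd h'.1 (h.2 _ hlt)
  have hSe : ∀ t ∈ Ioo a b, ∃ s, S t s := fun t ht => by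
    obtain ⟨s, hs, hmin⟩ := ((hfin t).subset (fun s (hs : BadPoint Y t s) => hs.1)).exists_minimal
      (s := {s | BadPoint Y t s}) (hBad t ht)
    exact ⟨s, (hS _ _).2 ⟨hs, fun s' hlt hs' => (hmin hs' hlt.le).not_gt hlt⟩⟩
  have c₁ := finite_not_cutContinuousAt (D := fun t z => ∃ s, S t s ∧ z ≤ s) (by fun_prop)
    fun t z z' hz ⟨s, hs, hzs⟩ => ⟨s, hs, hz.trans hzs⟩
  have c₂ := finite_not_cutContinuousAt (D := fun t z => ∃ s y, S t s ∧ Y t y ∧ y < s ∧ z ≤ y)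
    (by fun_prop) fun t z z' hz ⟨s, y, hs, hy, hys, hzs⟩ => ⟨s, y, hs, hy, hys, hz.trans hzs⟩
  have c₃ := finite_not_cutContinuousAt (D := fun t z => ∀ s y, S t s → Y t y → s < y → z < y)
    (Dm.all (Dm.all (Dm.imp (by fun_prop) (Dm.imp (by fun_prop)
      (Dm.imp (by fun_prop) (by fun_prop))))))
    fun t z z' hz h s y hs hy hys => hz.trans_lt (h s y hs hy hys)
  obtain ⟨t, ht, htc⟩ := (Ioo_infinite hab).exists_notMem_finite ((c₁.union c₂).union c₃)
  simp only [mem_union, mem_ofPred_eq, not_or, not_not] at htc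
  obtain ⟨⟨h₁, h₂⟩, h₃⟩ := htc
  obtain ⟨s, hs⟩ := hSe t ht
  obtain ⟨hYs, p, q, ⟨hps, hsq⟩, hpq, hnot⟩ := ((hS _ _).1 hs).1
  refine hnot ?_
  obtain ⟨p', hpp', hps'⟩ := exists_between hps
  obtain ⟨q', hsq', hqq'⟩ := exists_between hsq
  obtain ⟨z, hzp, hz⟩ := (hfin t).exists_lt_forall_lt p
  obtain ⟨w, hqw, hw⟩ := (hfin t).exists_gt_forall_lt q
  have e₁ := h₁.1 p' s hps' ⟨s, hs, le_rfl⟩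
  have e₂ := h₁.2 q' q hqq' fun ⟨s', hs', hle⟩ => hle.not_gt (hSu hs' hs ▸ hsq')
  have e₃ := h₂.2 z p hzp (by
    rintro ⟨s', y, hs', hy, hys, hzy⟩
    obtain rfl := hSu hs' hs
    refine (hz y hy (lt_of_not_ge fun hpy => ?_)).not_ge hzy
    exact hys.ne ((hpq y hpy (hys.le.trans hsq.le)).1 hy))
  have e₄ := h₃.1 q w hqw (by
    intro s' y hs' hy hys
    obtain rfl := hSu hs' hs
    refine hw y hy (lt_of_not_ge fun hpy => ?_)
    exact hys.ne' ((hpq y (hps.le.trans hys.le) hpy).1 hy))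
  filter_upwards [e₁, e₂, e₃, e₄, Ioo_mem_nhds ht.1 ht.2] with u e₁ e₂ e₃ e₄ hu
  obtain ⟨r, hr, hpr⟩ := e₁
  have hrq : r < q := lt_of_not_ge fun h => e₂ ⟨r, hr, h⟩
  refine ⟨r, ⟨hpp'.trans_le hpr, hrq⟩, fun y hpy hyq => ⟨fun hy => ?_, ?_⟩⟩
  · rcases lt_trichotomy y r with h | h | h
    · exact absurd ⟨r, y, hr, hy, h, hpy⟩ e₃
    · exact h
    · exact absurd hyq (e₄ r y hr hy h).not_ge
  · rintro rfl
    exact ((hS _ _).1 hr).1.1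

/-- A definable family of finite sets varies continuously off a finite set. -/
theorem finite_not_goodAt (hY : Dm R fun p : R × R => Y p.1 p.2)
    (hfin : ∀ t, {y | Y t y}.Finite) : {t | ¬ GoodAt Y t}.Finite := by
  have c₁ := finite_not_cutContinuousAt (D := fun t z => ∀ y, Y t y → z < y)
    (Dm.all (Dm.imp (by fun_prop) (by fun_prop)))
    fun t z z' hz h y hy => hz.trans_lt (h y hy)
  have c₂ := finite_not_cutContinuousAt (D := fun t z => ∃ y, Y t y ∧ z ≤ y) (by fun_prop)
    fun t z z' hz ⟨y, hy, h⟩ => ⟨y, hy, hz.trans h⟩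
  refine ((c₁.union c₂).union (finite_badPoint hY hfin)).subset fun t ht => ?_
  by_contra hcon
  simp only [mem_union, mem_ofPred_eq, not_or, not_not] at hcon
  refine ht ⟨fun q hq => ?_, fun q hq => ?_, fun s hs => hcon.2 ⟨s, hs⟩⟩
  · obtain ⟨w, hqw, hw⟩ := (hfin t).exists_gt_forall_lt q
    filter_upwards [hcon.1.1.1 q w hqw fun y hy => hw y hy (lt_of_not_ge fun h => hq y h hy)]
      with u hu y hy hYy using (hu y hYy).not_ge hy
  · obtain ⟨w, hqw, hw⟩ := (hfin t).exists_lt_forall_lt q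
    filter_upwards [hcon.1.2.2 w q hqw fun ⟨y, hy, hwy⟩ =>
      (hw y hy (lt_of_not_ge fun h => hq y h hy)).not_ge hwy]
      with u hu y hy hYy using hu ⟨y, hYy, hy⟩

theorem GoodAt.eventually_ncard_lt_eq {t : R} (hg : GoodAt Y t) (hfin : ∀ t, {y | Y t y}.Finite)
    {z : R} (hz : ¬ Y t z) : ∀ᶠ u in 𝓝 t, ¬ Y u z ∧
      {y | Y u y ∧ y < z}.ncard = {y | Y t y ∧ y < z}.ncard := by
  have hfin' : ∀ t z, {y | Y t y ∧ y < z}.Finite := fun t z => (hfin t).subset fun y hy => hy.1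
  induction hn : {y | Y t y ∧ y < z}.ncard generalizing z with
  | zero =>
    have h0 : {y | Y t y ∧ y < z} = ∅ := (ncard_eq_zero (hfin' t z)).1 hn
    have h1 : ∀ y, y ≤ z → ¬ Y t y := fun y hy hYy => by
      rcases hy.eq_or_lt with rfl | h
      · exact hz hYy
      · exact (h0.le ⟨hYy, h⟩ : y ∈ (∅ : Set R))
    filter_upwards [hg.bot z h1] with u hu
    refine ⟨hu z le_rfl, (ncard_eq_zero (hfin' u z)).2 ?_⟩
    exact eq_empty_of_forall_notMem fun y hy => hu y hy.2.le hy.1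
  | succ n ih =>
    obtain ⟨s, ⟨hs, hsz⟩, hmax⟩ := (hfin' t z).exists_maximal
      (nonempty_of_ncard_ne_zero (by lia))
    obtain ⟨p, hps, hp⟩ := (hfin t).exists_lt_forall_lt s
    have hiso : ∀ y, p ≤ y → y ≤ z → (Y t y ↔ y = s) := fun y hpy hyz => by
      refine ⟨fun hy => ?_, fun h => h ▸ hs⟩
      have hyz' : y < z := lt_of_le_of_ne hyz fun h => hz (h ▸ hy)
      rcases lt_trichotomy y s with h | h | h
      · exact absurd hpy (hp y hy h).not_ge
      · exact h
      · exact absurd (hmax ⟨hy, hyz'⟩ h.le) h.not_ge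
    have hcard : ∀ u, UniqueIn Y p z u →
        {y | Y u y ∧ y < z}.ncard = {y | Y u y ∧ y < p}.ncard + 1 := by
      rintro u ⟨y, ⟨hpy, hyz⟩, huniq⟩
      have : {y | Y u y ∧ y < z} = insert y {y | Y u y ∧ y < p} := by
        ext y'
        simp only [mem_ofPred_eq, mem_insert_iff]
        constructor
        · rintro ⟨h1, h2⟩
          rcases lt_or_ge y' p with h | h
          · exact .inr ⟨h1, h⟩
          · exact .inl ((huniq y' h h2.le).1 h1)
        · rintro (rfl | h)
          · exact ⟨(huniq y' hpy.le hyz.le).2 rfl, hyz⟩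
          · exact ⟨h.1, (h.2.trans hpy).trans hyz⟩
      rw [this, ncard_insert_of_notMem (fun h => h.2.not_gt hpy) (hfin' u p)]
    have hpY : ¬ Y t p := fun h => hps.ne ((hiso p le_rfl (hps.trans hsz).le).1 h)
    have hn' := hcard t ⟨s, ⟨hps, hsz⟩, hiso⟩
    have hev : ∀ᶠ u in 𝓝 t, UniqueIn Y p z u := by
      by_contra h
      exact hg.mid s ⟨hs, p, z, ⟨hps, hsz⟩, hiso, h⟩
    filter_upwards [hev, ih hpY (by lia)] with u hu hu'
    refine ⟨?_, by rw [hcard u hu, hu'.2]⟩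
    obtain ⟨y, ⟨hpy, hyz⟩, huniq⟩ := hu
    exact fun h => hyz.ne' ((huniq z (hpy.trans hyz).le le_rfl).1 h)

theorem GoodAt.eventually_ncard_eq {t : R} (hg : GoodAt Y t) (hfin : ∀ t, {y | Y t y}.Finite) :
    ∀ᶠ u in 𝓝 t, {y | Y u y}.ncard = {y | Y t y}.ncard := by
  obtain ⟨m, hm⟩ : ∃ m, ∀ y ∈ {y | Y t y}, y ≤ m := by
    have : Nonempty R := ⟨t⟩
    exact (hfin t).bddAbove
  obtain ⟨z, hmz⟩ := exists_gt m
  have hz : ∀ y, z ≤ y → ¬ Y t y := fun y hy h => (hmz.trans_le hy).not_ge (hm y h)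
  have hall : ∀ u, (∀ y, z ≤ y → ¬ Y u y) → {y | Y u y ∧ y < z} = {y | Y u y} := fun u hu => by
    ext y
    exact ⟨fun h => h.1, fun h => ⟨h, lt_of_not_ge fun h' => hu y h' h⟩⟩
  filter_upwards [hg.top z hz, hg.eventually_ncard_lt_eq hfin (hz z le_rfl)] with u hu hu'
  rw [← hall u hu, ← hall t hz, hu'.2]

end Good


section UniformFiniteness

theorem Dm.tail {n : ℕ} : Dm R fun x : Fin (n + 1) → X => (Fin.tail x : Fin n → X) :=
  Dm.pi fun i => Dm.apply i.succ

theorem Dm.insertNth {n : ℕ} (i : Fin (n + 1)) {f : X → Y} {g : X → Fin n → Y} (hf : Dm R f)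
    (hg : Dm R g) : Dm R fun x => (Fin.insertNth i (f x) (g x) : Fin (n + 1) → Y) := by
  refine Dm.pi fun j => ?_
  refine Fin.succAboveCases i ?_ (fun k => ?_) j
  · simpa using hf
  · simpa using (Dm.apply k).comp hg

theorem Dm.exists_le {P : ℕ → X → Prop} (hP : ∀ j, Dm R (P j)) (K : ℕ) :
    Dm R fun x => ∃ j ≤ K, P j x := by
  induction K with
  | zero => simpa using hP 0
  | succ K ih =>
    have h : ∀ x, (∃ j ≤ K + 1, P j x) ↔ (∃ j ≤ K, P j x) ∨ P (K + 1) x := fun x => by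
      constructor
      · rintro ⟨j, hj, h⟩
        rcases hj.lt_or_eq with hj | rfl
        · exact .inl ⟨j, by lia, h⟩
        · exact .inr h
      · rintro (⟨j, hj, h⟩ | h)
        · exact ⟨j, by lia, h⟩
        · exact ⟨_, le_rfl, h⟩
    simp only [h]
    exact ih.or (hP _)

variable [DenselyOrdered R] [NoMinOrder R] [NoMaxOrder R] [TopologicalSpace R] [OrderTopology R]

variable (R) in
/-- Definable families of finite sets indexed by `Rᵐ` are uniformly finite. -/
def UniformFinite (m : ℕ) : Prop :=
  ∀ Y : (Fin m → R) → R → Prop, Dm R (fun p : (Fin m → R) × R => Y p.1 p.2) →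
    (∀ x, {y | Y x y}.Finite) → ∃ K, ∀ x, {y | Y x y}.ncard ≤ K

/-- The set `B` is finite on every line parallel to the `i`-th axis. -/
def FiniteAlong {m : ℕ} (i : Fin m) (B : (Fin m → R) → Prop) : Prop :=
  ∀ x, {u | B (Function.update x i u)}.Finite

variable (R) in
/-- A sequence of definable sets that is pointwise eventually empty and locally constant in each
coordinate direction off a small definable set is eventually contained in a union of small
definable sets. -/
def EventuallySmall (m : ℕ) : Prop :=
  ∀ (S : ℕ → (Fin m → R) → Prop) (B : Fin m → (Fin m → R) → Prop),
    (∀ q, Dm R (S q)) → (∀ i, Dm R (B i)) → (∀ x, ∀ᶠ q in atTop, ¬ S q x) →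
    (∀ i, FiniteAlong i (B i)) →
    (∀ i x, ¬ B i x → ∀ᶠ u in 𝓝 (x i), ∀ q, (S q (Function.update x i u) ↔ S q x)) →
    ∃ B' : Fin m → (Fin m → R) → Prop, (∀ i, Dm R (B' i)) ∧ (∀ i, FiniteAlong i (B' i)) ∧
      ∀ᶠ q in atTop, ∀ x, S q x → ∃ i, B' i x

/-- `t` does not belong to the finite set `B` and has exactly `j` elements of `B` below it. -/
def InPiece (B : R → Prop) (j : ℕ) (t : R) : Prop := ¬ B t ∧ {s | B s ∧ s < t}.ncard = j

theorem InPiece.not_of_mem_Icc {B : R → Prop} (hB : {s | B s}.Finite) {j : ℕ} {t t' w : R}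
    (ht : InPiece B j t) (ht' : InPiece B j t') (hw : w ∈ Icc t t') : ¬ B w := by
  intro hBw
  have h1 : t < w := lt_of_le_of_ne hw.1 fun h => ht.1 (h ▸ hBw)
  have h2 : w < t' := lt_of_le_of_ne hw.2 fun h => ht'.1 (h ▸ hBw)
  have hlt : {s | B s ∧ s < t}.ncard < {s | B s ∧ s < t'}.ncard := by
    refine ncard_lt_ncard ⟨fun s hs => ⟨hs.1, (hs.2.trans h1).trans h2⟩, fun h => ?_⟩
      (hB.subset fun s hs => hs.1)
    exact (h ⟨hBw, h2⟩ : B w ∧ w < t).2.not_gt h1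
  rw [ht.2, ht'.2] at hlt
  exact hlt.false

theorem InPiece.iff {B P : R → Prop} (hP : Dm R P) (hB : {s | B s}.Finite)
    (hloc : ∀ w, ¬ B w → ∀ᶠ u in 𝓝 w, (P u ↔ P w)) {j : ℕ} {t t' : R}
    (ht : InPiece B j t) (ht' : InPiece B j t') : P t ↔ P t' := by
  rcases le_total t t' with h | h
  · exact hP.iff_of_forall_eventually_iff h fun w hw => hloc w (ht.not_of_mem_Icc hB ht' hw)
  · exact (hP.iff_of_forall_eventually_iff h fun w hw => hloc w (ht'.not_of_mem_Icc hB ht hw)).symm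

theorem Dm.inPiece {B : X → R → Prop} (hB : Dm R fun p : X × R => B p.1 p.2)
    (hfin : ∀ x, {s | B x s}.Finite) (j : ℕ) : Dm R fun p : X × R => InPiece (B p.1) j p.2 :=
  Dm.and (Dm.not hB) (Dm.ncard_lt_eq hB hfin j)

theorem GoodAt.eventually_inPiece {Y : R → R → Prop} {t z : R} (hg : GoodAt Y t)
    (hfin : ∀ t, {y | Y t y}.Finite) {j : ℕ} (hz : InPiece (Y t) j z) :
    ∀ᶠ u in 𝓝 t, InPiece (Y u) j z :=
  (hg.eventually_ncard_lt_eq hfin hz.1).mono fun _ hu => ⟨hu.1, hu.2.trans hz.2⟩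

theorem finite_cons_of_finiteAlong {m : ℕ} {B : (Fin (m + 1) → R) → Prop} (hB : FiniteAlong 0 B)
    (y : Fin m → R) : {t | B (Fin.cons t y)}.Finite := by
  rcases eq_empty_or_nonempty {t | B (Fin.cons t y)} with h | ⟨t₀, -⟩
  · rw [h]; exact finite_empty
  · simpa only [Fin.update_cons_zero] using hB (Fin.cons t₀ y)

theorem finite_insertNth_of_finiteAlong {m : ℕ} {i : Fin (m + 1)} {B : (Fin (m + 1) → R) → Prop}
    (hB : FiniteAlong i B) (y : Fin m → R) : {t | B (Fin.insertNth i t y)}.Finite := by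
  rcases eq_empty_or_nonempty {t | B (Fin.insertNth i t y)} with h | ⟨t₀, -⟩
  · rw [h]; exact finite_empty
  · simpa only [Fin.update_insertNth] using hB (Fin.insertNth i t₀ y)

theorem finite_not_goodAt_update {m : ℕ} {Y : (Fin m → R) → R → Prop}
    (hY : Dm R fun p : (Fin m → R) × R => Y p.1 p.2) (hfin : ∀ x, {y | Y x y}.Finite) (i : Fin m) :
    FiniteAlong i fun x => ¬ GoodAt (fun u => Y (Function.update x i u)) (x i) := by
  intro x
  simp only [Function.update_idem, Function.update_self]
  exact finite_not_goodAt (Y := fun u => Y (Function.update x i u)) (by fun_prop) fun _ => hfin _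

theorem Dm.not_goodAt_update {m : ℕ} {Y : (Fin m → R) → R → Prop}
    (hY : Dm R fun p : (Fin m → R) × R => Y p.1 p.2) (i : Fin m) :
    Dm R fun x => ¬ GoodAt (fun u => Y (Function.update x i u)) (x i) :=
  Dm.not (Dm.goodAt (Y := fun x u => Y (Function.update x i u)) (by fun_prop) (by fun_prop))

theorem EventuallySmall.of_piece {m : ℕ} (ihS : EventuallySmall R m)
    {S : ℕ → (Fin (m + 1) → R) → Prop} {B : Fin (m + 1) → (Fin (m + 1) → R) → Prop}
    (hS : ∀ q, Dm R (S q)) (hB : ∀ i, Dm R (B i)) (hev : ∀ x, ∀ᶠ q in atTop, ¬ S q x)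
    (hBfin : ∀ i, FiniteAlong i (B i))
    (hloc : ∀ i x, ¬ B i x → ∀ᶠ u in 𝓝 (x i), ∀ q, (S q (Function.update x i u) ↔ S q x)) (j : ℕ) :
    ∃ B' : Fin m → (Fin m → R) → Prop, (∀ i, Dm R (B' i)) ∧ (∀ i, FiniteAlong i (B' i)) ∧
      ∀ᶠ q in atTop, ∀ y, (∃ t, InPiece (fun s => B 0 (Fin.cons s y)) j t ∧ S q (Fin.cons t y)) →
        ∃ i, B' i y := by
  obtain ⟨C, hC⟩ : ∃ C : (Fin m → R) → R → Prop, ∀ y t, C y t ↔ B 0 (Fin.cons t y) :=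
    ⟨_, fun _ _ => Iff.rfl⟩
  have hCeq : ∀ y, (fun s => B 0 (Fin.cons s y)) = C y := fun y => funext fun s => propext (hC y s).symm
  have hCfin : ∀ y, {t | C y t}.Finite := fun y => by
    simpa only [hC] using finite_cons_of_finiteAlong (hBfin 0) y
  have hB0 := hB 0
  have hCd : Dm R fun p : (Fin m → R) × R => C p.1 p.2 := by simp only [hC]; fun_prop
  simp only [hCeq]
  obtain ⟨D, hD⟩ : ∃ D : (Fin m → R) → R → Prop, ∀ y t, D y t ↔ InPiece (C y) j t :=
    ⟨_, fun _ _ => Iff.rfl⟩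
  have hDd : Dm R fun p : (Fin m → R) × R => D p.1 p.2 := by
    simp only [hD]; exact Dm.inPiece hCd hCfin j
  have hconst : ∀ y t t', D y t → D y t' → ∀ q, (S q (Fin.cons t y) ↔ S q (Fin.cons t' y)) := by
    intro y t t' ht ht' q
    have hSq := hS q
    rw [hD] at ht ht'
    refine ht.iff (P := fun t => S q (Fin.cons t y)) (by fun_prop) (hCfin y) (fun w hw => ?_) ht'
    rw [hC] at hw
    have := hloc 0 _ hw
    simp only [Fin.update_cons_zero, Fin.cons_zero] at this
    exact this.mono fun u hu => hu q
  have hex : ∀ y z, D y z → ∀ q, (∃ t, D y t ∧ S q (Fin.cons t y)) ↔ S q (Fin.cons z y) :=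
    fun y z hz q => ⟨fun ⟨t, ht, h⟩ => (hconst y t z ht hz q).1 h, fun h => ⟨z, hz, h⟩⟩
  have hDgood : ∀ y i z, GoodAt (fun u => C (Function.update y i u)) (y i) → D y z →
      ∀ᶠ u in 𝓝 (y i), D (Function.update y i u) z := by
    intro y i z hg hz
    simp only [hD] at hz ⊢
    refine hg.eventually_inPiece (fun _ => hCfin _) ?_
    simpa only [Function.update_eq_self] using hz
  simp only [← hD]
  refine ihS (fun q y => ∃ t, D y t ∧ S q (Fin.cons t y))
    (fun i y => (¬ GoodAt (fun u => C (Function.update y i u)) (y i)) ∨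
      (¬ ∀ᶠ u in 𝓝 (y i), ((∃ z, D (Function.update y i u) z) ↔ ∃ z, D y z)) ∨
      ((∃ z, D y z) ∧ ¬ ∃ z, D y z ∧ ¬ B i.succ (Fin.cons z y)))
    (fun q => ?_) (fun i => ?_) (fun y => ?_) (fun i y => ?_) (fun i y hy => ?_)
  · have hSq := hS q
    fun_prop
  · have hBi := hB i.succ
    exact Dm.or (Dm.not_goodAt_update hCd i) (by fun_prop)
  · by_cases h : ∃ z, D y z
    · obtain ⟨z, hz⟩ := h
      simpa only [hex y z hz] using hev (Fin.cons z y)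
    · exact .of_forall fun q ⟨z, hz, _⟩ => h ⟨z, hz⟩
  · have f₁ := finite_not_goodAt_update hCd hCfin i y
    have f₂ : {u | ¬ ∀ᶠ v in 𝓝 u, ((∃ z, D (Function.update y i v) z) ↔
        ∃ z, D (Function.update y i u) z)}.Finite := by
      have hd : Dm R fun u => ∃ z, D (Function.update y i u) z := by fun_prop
      obtain ⟨F, hF, h⟩ := hd.exists_finite_eventually_iff
      exact hF.subset fun u hu => by_contra fun huF => hu (h u huF)
    have f₃ : {u | (∃ z, D (Function.update y i u) z) ∧ ¬ ∃ z, D (Function.update y i u) z ∧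
        ¬ B i.succ (Fin.cons z (Function.update y i u))}.Finite := by
      by_contra hinf
      have hBi := hB i.succ
      have hd : Dm R fun u => (∃ z, D (Function.update y i u) z) ∧
        ¬ ∃ z, D (Function.update y i u) z ∧ ¬ B i.succ (Fin.cons z (Function.update y i u)) := by
        fun_prop
      obtain ⟨a, b, hab, h⟩ := hd.exists_Ioo_of_infinite hinf
      obtain ⟨u₀, hu₀, hgood⟩ := (Ioo_infinite hab).exists_notMem_finite f₁
      simp only [Function.update_idem, Function.update_self, mem_ofPred_eq, not_not] at hgood
      obtain ⟨z, hz⟩ := (h u₀ hu₀).1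
      have hzev := hDgood (Function.update y i u₀) i z
        (by simpa only [Function.update_idem, Function.update_self] using hgood) hz
      simp only [Function.update_idem, Function.update_self] at hzev
      obtain ⟨a', b', hu', h'⟩ := mem_nhds_iff_exists_Ioo_subset.1
        (inter_mem hzev (Ioo_mem_nhds hu₀.1 hu₀.2))
      refine ((Ioo_infinite (hu'.1.trans hu'.2)).mono fun u hu => ?_) (hBfin i.succ (Fin.cons z y))
      have hzu := h' hu
      rw [mem_ofPred_eq, ← Fin.cons_update]
      by_contra hcon
      exact (h u hzu.2).2 ⟨z, hzu.1, hcon⟩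
    refine (f₁.union (f₂.union f₃)).subset fun u hu => ?_
    simpa only [mem_union, mem_ofPred_eq, Function.update_idem, Function.update_self] using hu
  · push Not at hy
    obtain ⟨hg, hn, hz⟩ := hy
    by_cases hne : ∃ z, D y z
    · obtain ⟨z, hz, hzB⟩ := hz hne
      have h1 := hloc i.succ _ hzB
      simp only [← Fin.cons_update, Fin.cons_succ] at h1
      filter_upwards [h1, hDgood y i z hg hz] with u hu hu' q
      rw [hex _ z hu', hex _ z hz, hu q]
    · filter_upwards [hn] with u hu q
      have hu' : ¬ ∃ z, D (Function.update y i u) z := fun h => hne (hu.1 h)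
      exact iff_of_false (fun ⟨z, hz, _⟩ => hu' ⟨z, hz⟩) fun ⟨z, hz, _⟩ => hne ⟨z, hz⟩

theorem EventuallySmall.succ {m : ℕ} (ihS : EventuallySmall R m) (ihU : UniformFinite R m) :
    EventuallySmall R (m + 1) := by
  intro S B hS hB hev hBfin hloc
  have hB0 := hB 0
  obtain ⟨K, hK⟩ := ihU (fun y t => B 0 (Fin.cons t y)) (by fun_prop)
    (finite_cons_of_finiteAlong (hBfin 0))
  choose B' hB'd hB'fin hB' using ihS.of_piece hS hB hev hBfin hloc
  refine ⟨Fin.cons (B 0) fun i x => ∃ j ≤ K, B' j i (Fin.tail x), ?_, ?_, ?_⟩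
  · refine Fin.cases hB0 fun i => ?_
    exact Dm.exists_le (fun j => (hB'd j i).comp Dm.tail) K
  · refine Fin.cases (hBfin 0) fun i x => ?_
    have : {u | ∃ j ≤ K, B' j i (Function.update (Fin.tail x) i u)} =
        ⋃ j ∈ {j | j ≤ K}, {u | B' j i (Function.update (Fin.tail x) i u)} := by
      ext u; simp
    simp only [Fin.cons_succ, Fin.tail_update_succ]
    rw [this]
    exact (finite_le_nat K).biUnion fun j _ => hB'fin j i _
  · filter_upwards [(eventually_all_finite (finite_le_nat K)).2 fun j _ => hB' j] with q hq x hx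
    by_cases h0 : B 0 x
    · exact ⟨0, h0⟩
    have hx' : x = Fin.cons (x 0) (Fin.tail x) := (Fin.cons_self_tail x).symm
    have hle : {s | B 0 (Fin.cons s (Fin.tail x)) ∧ s < x 0}.ncard ≤ K :=
      (ncard_le_ncard (fun s hs => hs.1) (finite_cons_of_finiteAlong (hBfin 0) _)).trans
        (hK (Fin.tail x))
    have h0' : ¬ B 0 (Fin.cons (x 0) (Fin.tail x)) := by rwa [← hx']
    obtain ⟨i, hi⟩ := hq _ hle (Fin.tail x) ⟨x 0, ⟨h0', rfl⟩, by rwa [← hx']⟩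
    exact ⟨i.succ, _, hle, hi⟩

theorem UniformFinite.succ {m : ℕ} (ihU : UniformFinite R m) (ihS : EventuallySmall R (m + 1)) :
    UniformFinite R (m + 1) := by
  intro Y hY hfin
  obtain ⟨B, hB, hBfin, hq⟩ := ihS (fun q x => q ≤ {y | Y x y}.ncard)
    (fun i x => ¬ GoodAt (fun u => Y (Function.update x i u)) (x i))
    (fun q => Dm.le_ncard hY hfin q) (fun i => Dm.not_goodAt_update hY i)
    (fun x => (eventually_gt_atTop {y | Y x y}.ncard).mono fun q hq => not_le.2 hq)
    (fun i => finite_not_goodAt_update hY hfin i) (fun i x hx => by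
      have := (not_not.1 hx).eventually_ncard_eq fun _ => hfin _
      simp only [Function.update_eq_self] at this
      filter_upwards [this] with u hu q
      rw [hu])
  obtain ⟨q, hq⟩ := hq.exists
  have hCd : ∀ i, Dm R fun p : (Fin m → R) × R => B i (Fin.insertNth i p.2 p.1) := fun i =>
    (hB i).comp (Dm.insertNth i Dm.snd Dm.fst)
  have hCfin : ∀ i x, {t | B i (Fin.insertNth i t x)}.Finite := fun i =>
    finite_insertNth_of_finiteAlong (hBfin i)
  choose K hK using fun i => ihU (fun x t => B i (Fin.insertNth i t x)) (hCd i) (hCfin i)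
  have hbound : ∀ i j, ∃ K', ∀ x, {r | ∃ t, (B i (Fin.insertNth i t x) ∧
      {s | B i (Fin.insertNth i s x) ∧ s < t}.ncard = j) ∧ Y (Fin.insertNth i t x) r}.Finite ∧
      {r | ∃ t, (B i (Fin.insertNth i t x) ∧
      {s | B i (Fin.insertNth i s x) ∧ s < t}.ncard = j) ∧ Y (Fin.insertNth i t x) r}.ncard ≤ K' := by
    intro i j
    have hfin' : ∀ x, {r | ∃ t, (B i (Fin.insertNth i t x) ∧
        {s | B i (Fin.insertNth i s x) ∧ s < t}.ncard = j) ∧ Y (Fin.insertNth i t x) r}.Finite := by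
      intro x
      rcases eq_empty_or_nonempty {t | B i (Fin.insertNth i t x) ∧
        {s | B i (Fin.insertNth i s x) ∧ s < t}.ncard = j} with h | ⟨t₀, ht₀⟩
      · refine finite_empty.subset fun r ⟨t, ht, _⟩ => ?_
        exact (h.le ht : t ∈ (∅ : Set R)).elim
      have huniq : ∀ t t', t < t' → (B i (Fin.insertNth i t x) ∧
          {s | B i (Fin.insertNth i s x) ∧ s < t}.ncard = j) →
          {s | B i (Fin.insertNth i s x) ∧ s < t'}.ncard ≠ j := by
        rintro t t' hlt ⟨ht, rfl⟩
        have hss : {s | B i (Fin.insertNth i s x) ∧ s < t} ⊂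
            {s | B i (Fin.insertNth i s x) ∧ s < t'} :=
          ⟨fun s hs => ⟨hs.1, hs.2.trans hlt⟩, fun h =>
            (h ⟨ht, hlt⟩ : B i (Fin.insertNth i t x) ∧ t < t).2.false⟩
        exact (ncard_lt_ncard hss ((hCfin i x).subset fun s hs => hs.1)).ne'
      refine (hfin (Fin.insertNth i t₀ x)).subset ?_
      rintro r ⟨t, ht, hr⟩
      rcases lt_trichotomy t t₀ with h | rfl | h
      · exact absurd ht₀.2 (huniq _ _ h ht)
      · exact hr
      · exact absurd ht.2 (huniq _ _ h ht₀)
    have hd : Dm R fun p : (Fin m → R) × R => ∃ t, (B i (Fin.insertNth i t p.1) ∧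
        {s | B i (Fin.insertNth i s p.1) ∧ s < t}.ncard = j) ∧ Y (Fin.insertNth i t p.1) p.2 := by
      refine Dm.ex (Dm.and (Dm.and ?_ ?_) ?_)
      · exact (hCd i).comp (g := fun p : ((Fin m → R) × R) × R => (p.1.1, p.2)) (by fun_prop)
      · exact (Dm.ncard_lt_eq (hCd i) (hCfin i) j).comp
          (g := fun p : ((Fin m → R) × R) × R => (p.1.1, p.2)) (by fun_prop)
      · exact hY.comp (g := fun p : ((Fin m → R) × R) × R => (Fin.insertNth i p.2 p.1.1, p.1.2))
          (Dm.prodMk (Dm.insertNth i (f := fun p : ((Fin m → R) × R) × R => p.2)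
            (g := fun p : ((Fin m → R) × R) × R => p.1.1) (by fun_prop) (by fun_prop))
            (by fun_prop))
    obtain ⟨K', hK'⟩ := ihU _ hd hfin'
    exact ⟨K', fun x => ⟨hfin' x, hK' x⟩⟩
  choose K' hK' using hbound
  refine ⟨q + ∑ i, ∑ j ∈ Finset.range (K i + 1), K' i j, fun x => ?_⟩
  rcases lt_or_ge {y | Y x y}.ncard q with hlt | hge
  · lia
  obtain ⟨i, hi⟩ := hq x hge
  have hx : Fin.insertNth i (x i) (i.removeNth x) = x := Fin.insertNth_self_removeNth i x
  have hle : {s | B i (Fin.insertNth i s (i.removeNth x)) ∧ s < x i}.ncard ≤ K i :=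
    (ncard_le_ncard (fun s hs => hs.1) (hCfin i _)).trans (hK i _)
  obtain ⟨hf, hb⟩ := hK' i {s | B i (Fin.insertNth i s (i.removeNth x)) ∧ s < x i}.ncard
    (i.removeNth x)
  have h1 : {y | Y x y}.ncard ≤
      K' i {s | B i (Fin.insertNth i s (i.removeNth x)) ∧ s < x i}.ncard := by
    refine (ncard_le_ncard (fun y hy => ?_) hf).trans hb
    exact ⟨x i, ⟨by rwa [hx], rfl⟩, by rwa [hx]⟩
  have h2 := Finset.single_le_sum (f := fun j => K' i j) (fun _ _ => Nat.zero_le _)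
    (Finset.mem_range.2 (Nat.lt_succ_of_le hle))
  have h3 := Finset.single_le_sum (f := fun i => ∑ j ∈ Finset.range (K i + 1), K' i j)
    (fun _ _ => Nat.zero_le _) (Finset.mem_univ i)
  exact h1.trans (h2.trans (h3.trans (Nat.le_add_left _ _)))

theorem uniformFinite (m : ℕ) : UniformFinite R m := by
  suffices EventuallySmall R m ∧ UniformFinite R m from this.2
  induction m with
  | zero =>
    refine ⟨fun S B _ _ hev _ _ => ⟨fun _ _ => False, fun i => i.elim0, fun i => i.elim0, ?_⟩,
      fun Y _ _ => ⟨{y | Y default y}.ncard, fun x => by rw [Subsingleton.elim x default]⟩⟩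
    filter_upwards [hev default] with q hq x hx
    exact absurd hx (Subsingleton.elim x default ▸ hq)
  | succ m ih =>
    have hS := ih.1.succ ih.2
    exact ⟨hS, ih.2.succ hS⟩

end UniformFiniteness

end OMinimalSystems

section Transfer

open Set Filter Topology

theorem Set.Finite.exists_subset_range {α : Type*} {s : Set α} (hs : s.Finite) {k : ℕ}
    (hk : s.ncard ≤ k) (a : α) : ∃ z : Fin (k + 1) → α, s ⊆ range z := by
  have e := hs.toFinset.equivFinOfCardEq (ncard_eq_toFinset_card s hs).symm
  refine ⟨fun i => if h : (i : ℕ) < s.ncard then e.symm ⟨i, h⟩ else a, fun y hy => ?_⟩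
  refine ⟨⟨e ⟨y, hs.mem_toFinset.2 hy⟩, (Fin.is_lt _).trans_le (hk.trans k.le_succ)⟩, ?_⟩
  simp

theorem IsOpenIntervalSet.exists_finite {M : Type w} [LinearOrder M] {s : Set M}
    (hs : IsOpenIntervalSet s) : ∃ E : Set M, E.Finite ∧
      ∀ x y, x < y → (∀ z ∈ E, z ∉ Icc x y) → (x ∈ s ↔ y ∈ s) := by
  rcases hs with ⟨a, b, rfl⟩ | ⟨a, rfl⟩ | ⟨b, rfl⟩ | rfl
  · refine ⟨{a, b}, by simp, fun x y hxy h => ?_⟩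
    simp only [mem_insert_iff, mem_singleton_iff, forall_eq_or_imp, forall_eq, mem_Icc] at h
    simp only [mem_Ioo]
    grind
  · refine ⟨{a}, by simp, fun x y hxy h => ?_⟩
    simp only [mem_singleton_iff, forall_eq, mem_Icc] at h
    simp only [mem_Ioi]
    grind
  · refine ⟨{b}, by simp, fun x y hxy h => ?_⟩
    simp only [mem_singleton_iff, forall_eq, mem_Icc] at h
    simp only [mem_Iio]
    grind
  · exact ⟨∅, by simp, by simp⟩

theorem IsFinUnionPointsIntervals.exists_finite {M : Type w} [LinearOrder M] {s : Set M}
    (hs : IsFinUnionPointsIntervals s) : ∃ E : Set M, E.Finite ∧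
      ∀ x y, x < y → (∀ z ∈ E, z ∉ Icc x y) → (x ∈ s ↔ y ∈ s) := by
  obtain ⟨F, n, J, hJ, rfl⟩ := hs
  choose E hE h using fun k => (hJ k).exists_finite
  refine ⟨F ∪ ⋃ k, E k, F.finite_toSet.union (finite_iUnion hE), fun x y hxy hz => ?_⟩
  have hx : x ∉ (F : Set M) := fun hx => hz x (.inl hx) ⟨le_rfl, hxy.le⟩
  have hy : y ∉ (F : Set M) := fun hy => hz y (.inl hy) ⟨hxy.le, le_rfl⟩
  simp only [mem_union, hx, hy, false_or, mem_iUnion]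
  exact exists_congr fun k => h k x y hxy fun z hzk => hz z (.inr (mem_iUnion.2 ⟨k, hzk⟩))

/-- A set bounded below by `c`, whose membership above `c` depends only on the position relative to
finitely many points, is a finite union of points and open intervals. -/
theorem isFinUnionPointsIntervals_of_forall_iff {N : Type x} [LinearOrder N] {s : Set N} {c : N}
    (hc : ∀ y ∈ s, c < y) {n : ℕ} (z : Fin n → N)
    (h : ∀ y y', c < y → c < y' → (∀ i, (y < z i ↔ y' < z i) ∧ (z i < y ↔ z i < y')) →
      (y ∈ s ↔ y' ∈ s)) : IsFinUnionPointsIntervals s := by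
  classical
  set Z : Finset N := insert c (Finset.univ.image z) with hZ
  have hzZ : ∀ i, z i ∈ Z := fun i => by simp [hZ]
  have hcZ : c ∈ Z := by simp [hZ]
  let A : Set (Set N) := {J | (IsOpenIntervalSet J ∧ J ⊆ s) ∧
    ((∃ p ∈ Z, ∃ q ∈ Z, J = Ioo p q) ∨ ∃ p ∈ Z, J = Ioi p)}
  have hA : A.Finite := by
    refine (((Z.finite_toSet.prod Z.finite_toSet).image fun p => Ioo p.1 p.2).union
      (Z.finite_toSet.image Ioi)).subset ?_
    rintro J ⟨-, ⟨p, hp, q, hq, rfl⟩ | ⟨p, hp, rfl⟩⟩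
    · exact .inl ⟨(p, q), ⟨hp, hq⟩, rfl⟩
    · exact .inr ⟨p, hp, rfl⟩
  have : Fintype A := hA.fintype
  refine ⟨Z.filter (· ∈ s), Fintype.card A, fun k => ((Fintype.equivFin A).symm k : Set N),
    fun k => ((Fintype.equivFin A).symm k).2.1.1, ?_⟩
  refine Subset.antisymm (fun y hy => ?_) (union_subset (by intro y; simp) (iUnion_subset
    fun k => ((Fintype.equivFin A).symm k).2.1.2))
  suffices H : y ∉ Z → ∃ J ∈ A, y ∈ J by
    by_cases hyZ : y ∈ Z
    · exact .inl (by simp [hyZ, hy])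
    obtain ⟨J, hJ, hyJ⟩ := H hyZ
    exact .inr (mem_iUnion.2 ⟨Fintype.equivFin A ⟨J, hJ⟩, by simpa using hyJ⟩)
  intro hyZ
  have hcy := hc y hy
  obtain ⟨p, hp, hpmax⟩ := (Z.filter (· < y)).exists_max_image id ⟨c, by simp [hcZ, hcy]⟩
  simp only [Finset.mem_filter, id_eq] at hp hpmax
  have hcp : c ≤ p := hpmax c ⟨hcZ, hcy⟩
  have hne : ∀ i, z i ≠ y := fun i hi => hyZ (hi ▸ hzZ i)
  rcases (Z.filter (y < ·)).eq_empty_or_nonempty with hemp | hnon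
  · have hall : ∀ r ∈ Z, ¬ y < r := fun r hr hyr => by
      simpa [hemp] using Finset.mem_filter.2 (⟨hr, hyr⟩ : r ∈ Z ∧ y < r)
    refine ⟨Ioi p, ⟨⟨.inr (.inl ⟨p, rfl⟩), fun y' hy' => ?_⟩, .inr ⟨p, hp.1, rfl⟩⟩, hp.2⟩
    refine (h y y' hcy (hcp.trans_lt hy') fun i => ?_).1 hy
    have hlt : z i < y := lt_of_le_of_ne (not_lt.1 (hall _ (hzZ i))) (hne i)
    have hlt' : z i < y' := (hpmax _ ⟨hzZ i, hlt⟩).trans_lt hy'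
    exact ⟨iff_of_false hlt.not_gt hlt'.not_gt, iff_of_true hlt hlt'⟩
  · obtain ⟨q, hq, hqmin⟩ := (Z.filter (y < ·)).exists_min_image id hnon
    simp only [Finset.mem_filter, id_eq] at hq hqmin
    refine ⟨Ioo p q, ⟨⟨.inl ⟨p, q, rfl⟩, fun y' hy' => ?_⟩,
      .inl ⟨p, hp.1, q, hq.1, rfl⟩⟩, hp.2, hq.2⟩
    refine (h y y' hcy (hcp.trans_lt hy'.1) fun i => ?_).1 hy
    rcases lt_or_gt_of_ne (hne i) with hlt | hgt
    · have hlt' : z i < y' := (hpmax _ ⟨hzZ i, hlt⟩).trans_lt hy'.1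
      exact ⟨iff_of_false hlt.not_gt hlt'.not_gt, iff_of_true hlt hlt'⟩
    · have hgt' : y' < z i := hy'.2.trans_le (hqmin _ ⟨hzZ i, hgt⟩)
      exact ⟨iff_of_true hgt hgt', iff_of_false hgt.not_gt hgt'.not_gt⟩

variable {L : FirstOrder.Language.{u, v}} [L.IsOrdered]

/-- The formula `a < b` in two variables. -/
def varLt {α : Type*} (a b : α) : L.Formula α := (Term.var (.inl a)).lt (Term.var (.inl b))

theorem realize_varLt {M : Type w} [LinearOrder M] [L.Structure M] [L.OrderedStructure M]
    {α : Type*} {a b : α} {v : α → M} : (varLt a b : L.Formula α).Realize v ↔ v a < v b := by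
  simp [varLt, Formula.Realize, Term.realize_lt]

variable {M : Type w} [LinearOrder M] [L.Structure M] [L.OrderedStructure M]

theorem IsUpwardOMinimal.exists_finite (hup : IsUpwardOMinimal L M) (c : M)
    (φ : L.Formula (M ⊕ Unit)) : ∃ E : Set M, E.Finite ∧ ∀ x y, c < x → x < y →
      (∀ z ∈ E, z ∉ Icc x y) →
      (φ.Realize (Sum.elim id fun _ => x) ↔ φ.Realize (Sum.elim id fun _ => y)) := by
  have hs : IsFinUnionPointsIntervals {x | c < x ∧ φ.Realize (Sum.elim id fun _ => x)} := by
    refine hup _ (definable_iff_exists_formula_sum.2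
      ⟨varLt (.inl ⟨c, mem_univ c⟩) (.inr 0) ⊓
        φ.relabel (Sum.map (fun a => ⟨a, mem_univ a⟩) fun _ => 0), ?_⟩) ⟨c, fun x hx => hx.1.le⟩
    ext v
    simp only [mem_ofPred_eq, Formula.realize_inf, realize_varLt, Formula.realize_relabel,
      Sum.elim_inl, Sum.elim_inr, Sum.elim_comp_map]
    rfl
  obtain ⟨E, hE, h⟩ := hs.exists_finite
  refine ⟨E, hE, fun x y hcx hxy hz => ?_⟩
  simpa [hcx, hcx.trans hxy] using h x y hxy hz

/-- The predicates on a final segment of an upward o-minimal structure that are definable in the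
ambient structure. -/
abbrev IsUpwardOMinimal.oMinSystem (hup : IsUpwardOMinimal L M) (c : M) : OMinSystem (Ioi c) where
  Dfn {ι} P := ∃ φ : L.Formula (M ⊕ ι), ∀ v, P v ↔ φ.Realize (Sum.elim id fun i => (v i : M))
  top := ⟨⊤, fun v => by simp⟩
  and := by
    rintro ι P Q ⟨φ, hφ⟩ ⟨ψ, hψ⟩
    exact ⟨φ ⊓ ψ, fun v => by simp only [Formula.realize_inf, hφ, hψ]⟩
  not := by
    rintro ι P ⟨φ, hφ⟩
    exact ⟨φ.not, fun v => by simp only [Formula.realize_not, hφ]⟩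
  ex := by
    rintro ι P ⟨φ, hφ⟩
    let e : M ⊕ Option ι → (M ⊕ ι) ⊕ Unit :=
      Sum.elim (fun a => .inl (.inl a)) fun o => o.elim (.inr ()) fun i => .inl (.inr i)
    refine ⟨((varLt (.inl (.inl c)) (.inr ()) ⊓ φ.relabel e).iExs Unit), fun v => ?_⟩
    have he : ∀ y : Unit → M, Sum.elim (Sum.elim id fun i => (v i : M)) y ∘ e =
        Sum.elim id fun o : Option ι => o.elim (y ()) fun i => (v i : M) := fun y => by
      funext o
      rcases o with a | _ | i <;> rfl
    simp only [Formula.realize_iExs, Formula.realize_inf, realize_varLt, Formula.realize_relabel,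
      Sum.elim_inl, Sum.elim_inr, he, id_eq]
    have key : ∀ x : Ioi c, P v x ↔
        φ.Realize (Sum.elim id fun o : Option ι => o.elim (x : M) fun i => (v i : M)) := fun x => by
      refine (hφ fun o => o.elim x v).trans (iff_of_eq ?_)
      congr 1
      funext o
      rcases o with a | _ | i <;> rfl
    constructor
    · rintro ⟨x, hx⟩
      exact ⟨fun _ => x, x.2, (key x).1 hx⟩
    · rintro ⟨y, hy, hφy⟩
      exact ⟨⟨y (), hy⟩, (key ⟨y (), hy⟩).2 hφy⟩
  subst := by
    rintro ι κ P e ⟨φ, hφ⟩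
    refine ⟨φ.relabel (Sum.elim .inl fun i => Sum.elim .inr (fun a : Ioi c => .inl (a : M)) (e i)),
      fun v => ?_⟩
    refine (hφ _).trans ?_
    rw [Formula.realize_relabel]
    refine iff_of_eq ?_
    congr 1
    funext o
    rcases o with a | i
    · rfl
    · rcases h : e i with j | a <;> simp [h]
  lt := ⟨varLt (.inr false) (.inr true), fun v => by simp [realize_varLt]⟩
  tame := by
    rintro P ⟨φ, hφ⟩
    obtain ⟨E, hE, h⟩ := hup.exists_finite c φ
    refine ⟨Subtype.val ⁻¹' E, hE.preimage Subtype.val_injective.injOn, fun x y hxy hz => ?_⟩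
    rw [hφ, hφ]
    exact h x y x.2 hxy fun z hzE hzI =>
      hz ⟨z, lt_of_lt_of_le x.2 hzI.1⟩ hzE hzI

variable [DenselyOrdered M] [NoMaxOrder M]

/-- In an upward o-minimal structure, the fibres of a definable family on a final segment are
determined by a bounded number of points. -/
theorem IsUpwardOMinimal.exists_uniform (hup : IsUpwardOMinimal L M) (c : M) {m : ℕ}
    (ψ : L.Formula (Fin m ⊕ Unit)) : ∃ k : ℕ, ∀ b : Fin m → M, (∀ i, c < b i) →
      ∃ z : Fin (k + 1) → M, ∀ y y' : M, c < y → c < y' →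
        (∀ i, (y < z i ↔ y' < z i) ∧ (z i < y ↔ z i < y')) →
        (ψ.Realize (Sum.elim b fun _ => y) ↔ ψ.Realize (Sum.elim b fun _ => y')) := by
  let := hup.oMinSystem c
  let : TopologicalSpace (Ioi c) := Preorder.topology _
  have : OrderTopology (Ioi c) := ⟨rfl⟩
  let P : (Fin m → Ioi c) → Ioi c → Prop := fun b y =>
    ψ.Realize (Sum.elim (fun i => (b i : M)) fun _ => (y : M))
  have hP' : OMinSystem.Dfn fun v : Fin m ⊕ Unit → Ioi c => ψ.Realize fun i => (v i : M) :=
    ⟨ψ.relabel .inr, fun v => by rw [Formula.realize_relabel]; rfl⟩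
  have hP : Dm (Ioi c) fun p : (Fin m → Ioi c) × Ioi c => P p.1 p.2 := by
    rintro ι p ⟨h₁, h₂⟩
    choose e₁ he₁ using h₁
    obtain ⟨e₂, he₂⟩ := h₂
    have := OMinSystem.subst (Sum.elim e₁ fun _ => e₂) hP'
    refine cast (congrArg _ (funext fun v => ?_)) this
    refine congrArg ψ.Realize (funext fun i => ?_)
    rcases i with i | i
    · simp [he₁]
    · simp [he₂]
  have hPb : ∀ b, Dm (Ioi c) (P b) := fun b => hP.comp (g := fun y => (b, y)) (by fun_prop)
  obtain ⟨k, hk⟩ := uniformFinite (R := Ioi c) m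
    (fun b y => ¬ ∀ᶠ u in 𝓝 y, (P b u ↔ P b y))
    (Dm.not (Dm.eventually_nhds Dm.snd (Dm.iff
      (hP.comp (g := fun q : ((Fin m → Ioi c) × Ioi c) × Ioi c => (q.1.1, q.2)) (by fun_prop))
      (hP.comp (g := fun q : ((Fin m → Ioi c) × Ioi c) × Ioi c => q.1) (by fun_prop)))))
    (fun b => by
      obtain ⟨F, hF, h⟩ := (hPb b).exists_finite_eventually_iff
      exact hF.subset fun y hy => by_contra fun hyF => hy (h y hyF))
  refine ⟨k, fun b hb => ?_⟩
  let b' : Fin m → Ioi c := fun i => ⟨b i, hb i⟩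
  have hfin : {y | ¬ ∀ᶠ u in 𝓝 y, (P b' u ↔ P b' y)}.Finite := by
    obtain ⟨F, hF, h⟩ := (hPb b').exists_finite_eventually_iff
    exact hF.subset fun y hy => by_contra fun hyF => hy (h y hyF)
  obtain ⟨z, hz⟩ : ∃ z : Fin (k + 1) → M, ∀ y ∈ {y | ¬ ∀ᶠ u in 𝓝 y, (P b' u ↔ P b' y)},
      (y : M) ∈ range z := by
    obtain ⟨z, hz⟩ := hfin.exists_subset_range (hk b') (Classical.arbitrary _)
    refine ⟨fun i => z i, fun y hy => ?_⟩
    obtain ⟨i, rfl⟩ := hz hy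
    exact ⟨i, rfl⟩
  have key : ∀ y y' : Ioi c, y ≤ y' →
      (∀ i, ((y : M) < z i ↔ (y' : M) < z i) ∧ (z i < y ↔ z i < y')) → (P b' y ↔ P b' y') := by
    intro y y' hle h
    rcases hle.eq_or_lt with rfl | hlt
    · rfl
    refine (hPb b').iff_of_forall_eventually_iff hle fun t ht => ?_
    by_contra hnot
    obtain ⟨i, hi⟩ := hz t hnot
    have h1 : (y : M) ≤ z i := hi ▸ ht.1
    have h2 : z i ≤ (y' : M) := hi ▸ ht.2
    have h3 : (y : M) < y' := hlt
    obtain ⟨h4, h5⟩ := h i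
    grind
  refine ⟨z, fun y y' hy hy' h => ?_⟩
  rcases le_total y y' with hle | hle
  · exact key ⟨y, hy⟩ ⟨y', hy'⟩ hle h
  · exact (key ⟨y', hy'⟩ ⟨y, hy⟩ hle fun i => ⟨(h i).1.symm, (h i).2.symm⟩).symm

/-- The formula with parameter `c` asserting that the fibres of `ψ` above `c` are determined by
`k` points. -/
noncomputable def uniformFormula (k : ℕ) {m : ℕ} (ψ : L.Formula (Fin m ⊕ Unit)) : L.Formula Unit :=
  let lower : L.Formula (Unit ⊕ Fin m) := Formula.iInf fun i : Fin m => varLt (.inl ()) (.inr i)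
  let same : L.Formula (((Unit ⊕ Fin m) ⊕ Fin k) ⊕ Bool) := Formula.iInf fun i : Fin k =>
    (varLt (.inr false) (.inl (.inr i))).iff (varLt (.inr true) (.inl (.inr i))) ⊓
    (varLt (.inl (.inr i)) (.inr false)).iff (varLt (.inl (.inr i)) (.inr true))
  let inst : Bool → L.Formula (((Unit ⊕ Fin m) ⊕ Fin k) ⊕ Bool) := fun β =>
    ψ.relabel (Sum.elim (fun i => .inl (.inl (.inr i))) fun _ => .inr β)
  (lower.imp <| Formula.iExs (Fin k) <| Formula.iAlls Bool <|
    (varLt (.inl (.inl (.inl ()))) (.inr false)).imp <|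
    (varLt (.inl (.inl (.inl ()))) (.inr true)).imp <|
    same.imp <| (inst false).iff (inst true)).iAlls (Fin m)

theorem realize_uniformFormula {M : Type*} [LinearOrder M] [L.Structure M] [L.OrderedStructure M]
    {k m : ℕ} {ψ : L.Formula (Fin m ⊕ Unit)} {c : M} :
    (uniformFormula k ψ).Realize (fun _ => c) ↔ ∀ b : Fin m → M, (∀ i, c < b i) →
      ∃ z : Fin k → M, ∀ y y' : M, c < y → c < y' →
        (∀ i, (y < z i ↔ y' < z i) ∧ (z i < y ↔ z i < y')) →
        (ψ.Realize (Sum.elim b fun _ => y) ↔ ψ.Realize (Sum.elim b fun _ => y')) := by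
  simp only [uniformFormula, Formula.realize_iAlls, Formula.realize_imp, Formula.realize_iExs,
    Formula.realize_iInf, Formula.realize_inf, Formula.realize_iff, realize_varLt,
    Formula.realize_relabel, Sum.elim_inl, Sum.elim_inr]
  have h : ∀ (b : Fin m → M) (z : Fin k → M) (t : Bool → M) (β : Bool),
      (fun a => Sum.elim (Sum.elim (fun a => Sum.elim (fun _ : Unit => c) b a) z) t a) ∘
        Sum.elim (fun i : Fin m => .inl (.inl (.inr i))) (fun _ : Unit => .inr β) =
      Sum.elim b fun _ => t β := by
    intro b z t β
    funext i
    rcases i with i | i <;> rfl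
  simp only [h]
  refine forall_congr' fun b => imp_congr_right fun _ => exists_congr fun z => ?_
  exact ⟨fun H y y' => H fun β => cond β y' y, fun H t => H _ _⟩

theorem IsUpwardOMinimal.of_coinitial [NoMinOrder M] {N : Type x} [LinearOrder N] [L.Structure N]
    [L.OrderedStructure N] (hup : IsUpwardOMinimal L M) (f : M ↪ₑ[L] N)
    (hcoinitial : ∀ y : N, ∃ x : M, f x ≤ y) : IsUpwardOMinimal L N := by
  classical
  have hf : ∀ a b : M, a < b → f a < f b := fun a b hab => by
    have := f.map_formula (varLt false true) fun β => cond β b a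
    rwa [realize_varLt, realize_varLt, cond_false, cond_true, iff_true_right hab] at this
  have hlt : ∀ y : N, ∃ x : M, f x < y := fun y => by
    obtain ⟨a, ha⟩ := hcoinitial y
    obtain ⟨a', ha'⟩ := exists_lt a
    exact ⟨a', (hf _ _ ha').trans_le ha⟩
  rintro s hs ⟨d, hd⟩
  obtain ⟨φ, hφ⟩ := definable_iff_exists_formula_sum.1 hs
  have hφ' : ∀ y, y ∈ s ↔ φ.Realize (Sum.elim (↑) fun _ => y) := fun y =>
    Set.ext_iff.1 hφ fun _ => y
  obtain ⟨m, b, ψ, hψ⟩ : ∃ (m : ℕ) (b : Fin m → N) (ψ : L.Formula (Fin m ⊕ Unit)),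
      ∀ y, y ∈ s ↔ ψ.Realize (Sum.elim b fun _ => y) := by
    let S := φ.freeVarFinset
    let e := Fintype.equivFin S
    refine ⟨Fintype.card S, fun i => Sum.elim Subtype.val (fun _ : Fin 1 => d) (e.symm i).1,
      φ.restrictFreeVar fun a => Sum.elim (fun _ => .inl (e a)) (fun _ => .inr ()) a.1, fun y => ?_⟩
    rw [hφ']
    refine (BoundedFormula.realize_restrictFreeVar _ ?_).symm
    rintro ⟨a | i, ha⟩
    · simp [e]
    · simp
  obtain ⟨c, hcd, hcb⟩ : ∃ c : M, f c < d ∧ ∀ i, f c < b i := by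
    choose g hg using hlt
    obtain ⟨c, -, hc⟩ := (insert (g d) (Finset.univ.image fun i => g (b i))).exists_min_image id
      (Finset.insert_nonempty _ _)
    have hle : ∀ a b, a ≤ b → f a ≤ f b := fun a b h => by
      rcases h.eq_or_lt with rfl | h
      · rfl
      · exact (hf _ _ h).le
    exact ⟨c, (hle _ _ (hc (g d) (by simp))).trans_lt (hg d),
      fun i => (hle _ _ (hc (g (b i)) (by simp))).trans_lt (hg _)⟩
  obtain ⟨k, hk⟩ := hup.exists_uniform c ψ
  have hN := realize_uniformFormula.1
    ((f.map_formula (uniformFormula (k + 1) ψ) fun _ => c).2 (realize_uniformFormula.2 hk))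
  obtain ⟨z, hz⟩ := hN b hcb
  refine isFinUnionPointsIntervals_of_forall_iff (fun y hy => hcd.trans_le (hd hy)) z
    fun y y' hy hy' h => ?_
  rw [hψ, hψ]
  exact hz y y' hy hy' h

end Transfer

open scoped FirstOrder

/-- Let `M` be an almost o-minimal structure that is not o-minimal, and
suppose `M` is upward o-minimal.  Let `N` be an elementary extension of `M` (given by an
elementary embedding `f : M ↪ₑ[L] N` of ordered `L`-structures) in which `M` is coinitial,
i.e. every element of `N` is `≥ f x` for some `x ∈ M`.  Then `N` is upward o-minimal. -/
theorem upward_ominimal_of_coinitial_elementary_extension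
    {L : FirstOrder.Language.{u, v}} [L.IsOrdered] {M : Type w}
    [LinearOrder M] [L.Structure M] [L.OrderedStructure M]
    [DenselyOrdered M] [NoMinOrder M] [NoMaxOrder M]
    {N : Type x} [LinearOrder N] [L.Structure N] [L.OrderedStructure N]
    (halmost : IsAlmostOMinimal L M) (hnotomin : ¬ IsOMinimal L M)
    (hup : IsUpwardOMinimal L M)
    (f : M ↪ₑ[L] N) (hcoinitial : ∀ y : N, ∃ x : M, f x ≤ y) :
    IsUpwardOMinimal L N := by
  exact hup.of_coinitial f hcoinitial
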